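/- arXiv:math/0004113 — 6 statements merged into one kernel-verified Lean document; each statement's English description precedes it below -/
import Mathlib

section
/- Let R be a commutative ring, let r ≥ 1, and let A be an (r+1)×(r+1) matrix over R (rows and columns indexed 1,…,r+1). For index ranges, write A_{{a,b},{c,d}} for the submatrix of A consisting of rows a,a+1,…,b and columns c,c+1,…,d. Then det(A)·det(A_{{2,r},{2,r}}) = det(A_{{1,r},{1,r}})·det(A_{{2,r+1},{2,r+1}}) − det(A_{{2,r+1},{1,r}})·det(A_{{1,r},{2,r+1}}). (Dodgson's condensation formula / Desnanot–Jacobi adjoint matrix theorem; here the determinant of a 0×0 matrix is 1.) -/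
namespace Matrix

variable {R m n : Type*} [CommRing R] [Fintype m] [Fintype n] [DecidableEq m] [DecidableEq n]

theorem det_mul_det_toBlocks₁₁_adjugate (A : Matrix (m ⊕ n) (m ⊕ n) R) :
    A.det * A.adjugate.toBlocks₁₁.det = A.det ^ Fintype.card m * A.toBlocks₂₂.det := by
  have hA := A.mul_adjugate
  rw [← fromBlocks_toBlocks A.adjugate] at hA
  nth_rw 1 [← fromBlocks_toBlocks A] at hA
  rw [fromBlocks_multiply, ← fromBlocks_one, fromBlocks_smul, fromBlocks_inj] at hA
  obtain ⟨h₁₁, -, h₂₁, -⟩ := hA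
  have hmul : A * fromBlocks A.adjugate.toBlocks₁₁ 0 A.adjugate.toBlocks₂₁ 1 =
      fromBlocks (A.det • 1) A.toBlocks₁₂ 0 A.toBlocks₂₂ := by
    nth_rw 1 [← fromBlocks_toBlocks A]
    rw [fromBlocks_multiply, h₁₁, h₂₁]
    simp
  simpa using congrArg det hmul

/-- **Jacobi's complementary minor formula** for a principal block of the adjugate. -/
theorem det_toBlocks₁₁_adjugate [Nonempty m] (A : Matrix (m ⊕ n) (m ⊕ n) R) :
    A.adjugate.toBlocks₁₁.det = A.det ^ (Fintype.card m - 1) * A.toBlocks₂₂.det := by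
  let X := mvPolynomialX (m ⊕ n) (m ⊕ n) ℤ
  have hX : X.adjugate.toBlocks₁₁.det = X.det ^ (Fintype.card m - 1) * X.toBlocks₂₂.det := by
    apply mul_left_cancel₀ (det_mvPolynomialX_ne_zero (m ⊕ n) ℤ)
    rw [det_mul_det_toBlocks₁₁_adjugate, ← mul_assoc, mul_pow_sub_one Fintype.card_ne_zero]
  let f := MvPolynomial.aeval (R := ℤ) fun p : (m ⊕ n) × (m ⊕ n) => A p.1 p.2
  have hf : f.mapMatrix X = A := mvPolynomialX_mapMatrix_aeval ℤ A
  have h₁₁ : f.mapMatrix X.adjugate.toBlocks₁₁ = A.adjugate.toBlocks₁₁ := by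
    rw [← hf, ← AlgHom.map_adjugate]
    rfl
  have h₂₂ : f.mapMatrix X.toBlocks₂₂ = A.toBlocks₂₂ := by
    rw [← hf]
    rfl
  rw [← h₁₁, ← h₂₂, ← AlgHom.map_det, hX, map_mul, map_pow, AlgHom.map_det, AlgHom.map_det, hf]

end Matrix

/-- The equivalence separating the two end points of `Fin (n + 2)` from its interior points. -/
noncomputable def finEndsSumInteriorEquiv (n : ℕ) : Fin 2 ⊕ Fin n ≃ Fin (n + 2) :=
  Equiv.ofBijective (Sum.elim ![0, Fin.last (n + 1)] fun i => i.castSucc.succ) <| by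
    rw [Fintype.bijective_iff_injective_and_card]
    refine ⟨?_, by simp [add_comm]⟩
    rintro (i | i) (j | j) h
    · fin_cases i <;> fin_cases j <;> simp_all [Fin.ext_iff]
    · have := j.isLt
      fin_cases i <;> simp_all [Fin.ext_iff, Nat.ne_of_gt]
    · have := i.isLt
      fin_cases j <;> simp_all [Fin.ext_iff, Nat.ne_of_lt]
    · simpa [Fin.ext_iff] using h

/-- **Dodgson's condensation formula (Desnanot–Jacobi adjoint matrix theorem).**
For an `(r+1) × (r+1)` matrix `A` over a commutative ring (rows and columns
indexed `0, …, r` here, corresponding to `1, …, r+1` in the classical statement),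
`det A · det A_{{2,r},{2,r}} = det A_{{1,r},{1,r}} · det A_{{2,r+1},{2,r+1}}
  − det A_{{2,r+1},{1,r}} · det A_{{1,r},{2,r+1}}`,
where `A_{{a,b},{c,d}}` is the submatrix with rows `a, …, b` and columns `c, …, d`
(1-indexed), and the determinant of a `0 × 0` matrix is `1`. -/
theorem dodgson_condensation {R : Type*} [CommRing R] (r : ℕ) (hr : 1 ≤ r)
    (A : Matrix (Fin (r + 1)) (Fin (r + 1)) R) :
    A.det *
      (A.submatrix (fun i : Fin (r - 1) => (⟨(i : ℕ) + 1, by omega⟩ : Fin (r + 1)))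
        (fun j : Fin (r - 1) => (⟨(j : ℕ) + 1, by omega⟩ : Fin (r + 1)))).det
    = (A.submatrix Fin.castSucc Fin.castSucc).det * (A.submatrix Fin.succ Fin.succ).det
      - (A.submatrix Fin.succ Fin.castSucc).det * (A.submatrix Fin.castSucc Fin.succ).det := by
  obtain ⟨n, rfl⟩ := Nat.exists_eq_add_of_le' hr
  let e := finEndsSumInteriorEquiv n
  have key := Matrix.det_toBlocks₁₁_adjugate (A.submatrix e e)
  have h0 : e (Sum.inl 0) = 0 := rfl
  have h1 : e (Sum.inl 1) = Fin.last (n + 1) := rfl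
  have hsign : ((-1 : R) ^ (n + 1)) * (-1) ^ (n + 1) = 1 := by
    rw [← mul_pow]
    simp
  have hint : (A.submatrix e e).toBlocks₂₂ =
      A.submatrix (fun i : Fin n => i.castSucc.succ) fun i : Fin n => i.castSucc.succ := rfl
  rw [Matrix.adjugate_submatrix_equiv_self, Matrix.det_submatrix_equiv_self, hint,
    Matrix.det_fin_two] at key
  simp only [Matrix.toBlocks₁₁, Matrix.of_apply, Matrix.submatrix_apply, h0, h1,
    Matrix.adjugate_fin_succ_eq_det_submatrix, Fin.succAbove_last, Fin.succAbove_zero,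
    Fin.val_last, Fin.val_zero, add_zero, zero_add, pow_zero, one_mul, pow_add _ (n + 1) (n + 1),
    hsign, Fintype.card_fin, Nat.add_one_sub_one, pow_one] at key
  refine key.symm.trans ?_
  linear_combination (-(A.submatrix Fin.succ Fin.castSucc).det *
    (A.submatrix Fin.castSucc Fin.succ).det) * hsign
end

section
/- Plücker relations: Let R be a commutative ring, n ≥ 1, and let M be a 2n×n matrix over R with rows indexed 1,2,…,2n. For a list of row indices i_1,…,i_n, write [i_1,…,i_n] for the determinant of the n×n matrix whose p-th row is row i_p of M. Fix 0 ≤ k ≤ n and integers 1 ≤ r_1 < r_2 < … < r_k ≤ n. Then [1,2,…,n]·[n+1,n+2,…,2n] = Σ_{n+1 ≤ s_1 < s_2 < … < s_k ≤ 2n} [1,…,s_1,…,s_k,…,n]·[n+1,…,r_1,…,r_k,…,2n], where in the first factor of each summand the entry r_t of the list (1,2,…,n) is replaced by s_t (for t = 1,…,k, keeping all entries in their positions), and in the second factor the entry s_t of the list (n+1,…,2n) is replaced by r_t. -/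
open scoped Classical

namespace Matrix

variable {R : Type*} {n k : ℕ}

/-- The matrix `A` with the rows listed by `r` replaced by the vectors `v`. -/
noncomputable def extendRows (r : Fin k → Fin n) (v : Fin k → Fin n → R)
    (A : Matrix (Fin n) (Fin n) R) : Matrix (Fin n) (Fin n) R :=
  Matrix.of (Function.extend r v A.row)

theorem row_extendRows (r : Fin k → Fin n) (v : Fin k → Fin n → R)
    (A : Matrix (Fin n) (Fin n) R) : (extendRows r v A).row = Function.extend r v A.row := rfl

theorem extendRows_update [DecidableEq (Fin k)] {r : Fin k → Fin n} (hr : Function.Injective r)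
    (v : Fin k → Fin n → R) (A : Matrix (Fin n) (Fin n) R) (t : Fin k) (x : Fin n → R) :
    extendRows r (Function.update v t x) A = updateRow (extendRows r v A) (r t) x := by
  ext p j
  by_cases h : ∃ u, r u = p
  · obtain ⟨u, rfl⟩ := h
    by_cases hu : u = t
    · subst hu
      simp [extendRows, hr.extend_apply]
    · simp [extendRows, hr.extend_apply, hu, hr.ne hu]
  · rw [updateRow_ne (fun hp => h ⟨t, hp.symm⟩)]
    simp [extendRows, Function.extend_apply' _ _ _ h]

theorem extendRows_map {S : Type*} (g : R → S) (r : Fin k → Fin n) (v : Fin k → Fin n → R)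
    (A : Matrix (Fin n) (Fin n) R) :
    (extendRows r v A).map g = extendRows r (fun t => g ∘ v t) (A.map g) := by
  ext p j
  exact congrFun (Function.apply_extend (fun w => g ∘ w) r A.row p (g := v)) j

variable [CommRing R]

/-- The determinant of `A` with the rows listed by `r` replaced by `v`, as an alternating map
in `v`. -/
noncomputable def detExtend {r : Fin k → Fin n} (hr : Function.Injective r)
    (A : Matrix (Fin n) (Fin n) R) : (Fin n → R) [⋀^Fin k]→ₗ[R] R where
  toFun v := det (extendRows r v A)
  map_update_add' v t x y := by
    simp only [extendRows_update hr, det_updateRow_add]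
  map_update_smul' v t c x := by
    simp only [extendRows_update hr, det_updateRow_smul, smul_eq_mul]
  map_eq_zero_of_eq' v i j h hij := by
    refine det_zero_of_row_eq (hr.ne hij) ?_
    change (extendRows r v A).row _ = (extendRows r v A).row _
    rw [row_extendRows, hr.extend_apply, hr.extend_apply, h]

theorem detExtend_apply {r : Fin k → Fin n} (hr : Function.Injective r)
    (A : Matrix (Fin n) (Fin n) R) (v : Fin k → Fin n → R) :
    detExtend hr A v = det (extendRows r v A) := rfl

theorem detExtend_self {r : Fin k → Fin n} (hr : Function.Injective r)
    (A : Matrix (Fin n) (Fin n) R) : detExtend hr A (A.row ∘ r) = det A := by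
  rw [detExtend_apply]
  congr 1
  ext p j
  by_cases h : ∃ t, r t = p
  · obtain ⟨t, rfl⟩ := h
    simp [extendRows, hr.extend_apply]
  · simp [extendRows, Function.extend_apply' _ _ _ h]

theorem detExtend_eq_zero {s : Fin k → Fin n} (hs : Function.Injective s)
    (B : Matrix (Fin n) (Fin n) R) {f : Fin k → Fin n} {t : Fin k} (ht : f t ∉ Set.range s) :
    detExtend hs B (B.row ∘ f) = 0 := by
  refine det_zero_of_row_eq (i := s t) (j := f t) (fun h => ht ⟨t, h⟩) ?_
  change (extendRows s _ B).row _ = (extendRows s _ B).row _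
  rw [row_extendRows, hs.extend_apply, Function.extend_apply' _ _ _ ht, Function.comp_apply]

/-- The expansion of an alternating map on tuples of rows of `B`. -/
theorem det_mul_apply_rows (B : Matrix (Fin n) (Fin n) R)
    (F : (Fin n → R) [⋀^Fin k]→ₗ[R] R) {f : Fin k → Fin n} (hf : Function.Injective f) :
    det B * F (B.row ∘ f) =
      ∑ s : {s : Fin k → Fin n // StrictMono s},
        F (B.row ∘ s.1) * detExtend s.2.injective B (B.row ∘ f) := by
  set σ := Tuple.sort f
  have hs : StrictMono (f ∘ σ) :=
    (Tuple.monotone_sort f).strictMono_of_injective (hf.comp σ.injective)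
  have perm (G : (Fin n → R) [⋀^Fin k]→ₗ[R] R) :
      G (B.row ∘ f) = Equiv.Perm.sign σ • G (B.row ∘ f ∘ σ) := by
    rw [← Function.comp_assoc, G.map_perm, smul_smul, Int.units_mul_self, one_smul]
  rw [Finset.sum_eq_single ⟨f ∘ σ, hs⟩]
  · rw [perm (detExtend _ B), detExtend_self, perm F, mul_smul_comm, mul_smul_comm, mul_comm]
  · rintro ⟨s, h⟩ - hne
    suffices ∃ t, f t ∉ Set.range s by
      obtain ⟨t, ht⟩ := this
      rw [detExtend_eq_zero _ _ ht, mul_zero]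
    by_contra! hall
    choose g hg using hall
    have hgs : Function.Surjective g := Finite.surjective_of_injective fun a b hab =>
      hf (by rw [← hg a, ← hg b, hab])
    refine hne (Subtype.ext ((h.range_inj hs).1 ?_))
    rw [EquivLike.range_comp f σ, ← hgs.range_comp s]
    exact congrArg Set.range (funext hg)
  · exact fun h => absurd (Finset.mem_univ _) h

/-- The expansion of an alternating map in the rows of a matrix with regular determinant. -/
theorem det_mul_apply_of_isRegular {B : Matrix (Fin n) (Fin n) R} (hB : IsRegular B.det)
    (F : (Fin n → R) [⋀^Fin k]→ₗ[R] R) (v : Fin k → Fin n → R) :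
    det B * F v = ∑ s : {s : Fin k → Fin n // StrictMono s},
      F (B.row ∘ s.1) * detExtend s.2.injective B v := by
  let G : (Fin n → R) [⋀^Fin k]→ₗ[R] R := ∑ s : {s : Fin k → Fin n // StrictMono s},
      F (B.row ∘ s.1) • detExtend s.2.injective B
  have hG (w : Fin k → Fin n → R) : G w = ∑ s : {s : Fin k → Fin n // StrictMono s},
      F (B.row ∘ s.1) * detExtend s.2.injective B w :=
    map_sum (⟨⟨fun H => H w, rfl⟩, fun _ _ => rfl⟩ : ((Fin n → R) [⋀^Fin k]→ₗ[R] R) →+ R) _ _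
  have hcomp : (det B • F).compLinearMap B.vecMulLinear = G.compLinearMap B.vecMulLinear := by
    refine Module.Basis.ext_alternating (Pi.basisFun R (Fin n)) fun f hf => ?_
    have hrow : (fun t => B.vecMulLinear (Pi.basisFun R (Fin n) (f t))) = B.row ∘ f := by
      funext t
      simp only [Pi.basisFun_apply, vecMulLinear_apply, single_one_vecMul]
      rfl
    have h := det_mul_apply_rows B F hf
    rw [← hG] at h
    change det B * F (fun t => B.vecMulLinear (Pi.basisFun R (Fin n) (f t))) =
      G (fun t => B.vecMulLinear (Pi.basisFun R (Fin n) (f t)))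
    rw [hrow, h]
  have hv : (fun t => B.vecMulLinear (v t ᵥ* B.adjugate)) = fun t => det B • v t := by
    funext t
    simp [vecMul_vecMul, adjugate_mul, vecMul_smul]
  have h : (det B • F) (fun t => B.vecMulLinear (v t ᵥ* B.adjugate)) =
      G (fun t => B.vecMulLinear (v t ᵥ* B.adjugate)) :=
    DFunLike.congr_fun hcomp fun t => v t ᵥ* B.adjugate
  rw [hv] at h
  have hsmul (H : (Fin n → R) [⋀^Fin k]→ₗ[R] R) :
      H (fun t => det B • v t) = det B ^ k * H v := by
    simpa using H.toMultilinearMap.map_smul_univ (fun _ => det B) v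
  rw [hsmul, hsmul] at h
  rw [← hG]
  exact (hB.pow k).left h

theorem det_mul_det_eq_sum_of_isRegular (A : Matrix (Fin n) (Fin n) R)
    {B : Matrix (Fin n) (Fin n) R} (hB : IsRegular B.det) {r : Fin k → Fin n}
    (hr : StrictMono r) :
    det A * det B = ∑ s ∈ Finset.univ.filter (fun s : Fin k → Fin n => StrictMono s),
      det (extendRows r (B.row ∘ s) A) *
        det (extendRows s (A.row ∘ r) B) := by
  have h := det_mul_apply_of_isRegular hB (detExtend hr.injective A) (A.row ∘ r)
  rw [detExtend_self, mul_comm] at h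
  rw [h, ← Finset.sum_subtype_eq_sum_filter, Finset.subtype_univ]
  rfl

open Polynomial in
theorem det_mul_det_eq_sum (A B : Matrix (Fin n) (Fin n) R) {r : Fin k → Fin n}
    (hr : StrictMono r) :
    det A * det B = ∑ s ∈ Finset.univ.filter (fun s : Fin k → Fin n => StrictMono s),
      det (extendRows r (B.row ∘ s) A) *
        det (extendRows s (A.row ∘ r) B) := by
  have hreg : IsRegular (charmatrix (-B)).det := (charpoly_monic (-B)).isRegular
  have h := congrArg (evalRingHom (0 : R))
    (det_mul_det_eq_sum_of_isRegular (A.map C) hreg hr)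
  have hA : (evalRingHom (0 : R)).mapMatrix (A.map C) = A := by
    ext i j
    simp
  have hB : (evalRingHom (0 : R)).mapMatrix (charmatrix (-B)) = B := by
    ext i j
    simp [charmatrix_apply, diagonal_apply, apply_ite]
  rw [RingHom.mapMatrix_apply] at hA hB
  have hrow (P : Matrix (Fin n) (Fin n) R[X]) (g : Fin k → Fin n) :
      (fun t => evalRingHom (0 : R) ∘ (P.row ∘ g) t) = (P.map (evalRingHom (0 : R))).row ∘ g := rfl
  simpa only [map_mul, map_sum, RingHom.map_det, RingHom.mapMatrix_apply, extendRows_map, hrow,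
    hA, hB] using h

end Matrix

/-- **Plücker relations.** Let `M` be a `2n × n` matrix over a commutative ring,
with the rows indexed by `Fin (n + n)` (the first block `Fin.castAdd n`
corresponding to rows `1, …, n` and the second block `Fin.natAdd n` to rows
`n+1, …, 2n`).  For a choice `p ↦ f p` of `n` rows, `[f] = det (M.submatrix f id)`
is the corresponding `n × n` minor.  Fix `0 ≤ k ≤ n` and a strictly increasing
sequence `r : Fin k → Fin n` (the rows `r_1 < … < r_k` of the first block).  Then
`[1,…,n]·[n+1,…,2n] = Σ_{s_1 < … < s_k} [1,…,s_1,…,s_k,…,n]·[n+1,…,r_1,…,r_k,…,2n]`,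
the sum being over all strictly increasing `s : Fin k → Fin n` (representing rows
`n + s_1 < … < n + s_k` of the second block), where in the first factor the entry
`r_t` is replaced by `n + s_t` (in its position) and in the second factor the
entry `n + s_t` is replaced by `r_t`. -/
theorem pluecker_relations {R : Type*} [CommRing R] (n : ℕ) (hn : 1 ≤ n)
    (M : Matrix (Fin (n + n)) (Fin n) R) (k : ℕ) (hk : k ≤ n)
    (r : Fin k → Fin n) (hr : StrictMono r) :
    (M.submatrix (Fin.castAdd n) id).det * (M.submatrix (Fin.natAdd n) id).det
    = ∑ s ∈ Finset.univ.filter (fun s : Fin k → Fin n => StrictMono s),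
        (M.submatrix
            (fun p : Fin n =>
              if h : ∃ t, r t = p then Fin.natAdd n (s (Classical.choose h))
              else Fin.castAdd n p) id).det *
        (M.submatrix
            (fun p : Fin n =>
              if h : ∃ t, s t = p then Fin.castAdd n (r (Classical.choose h))
              else Fin.natAdd n p) id).det := by
  have hrows (f g : Fin k → Fin n) (a b : Fin n → Fin (n + n)) :
      M.submatrix (Function.extend f (a ∘ g) b) id =
        Matrix.extendRows f ((M.submatrix a id).row ∘ g) (M.submatrix b id) := by
    ext p j
    exact congrFun (Function.apply_extend M.row f b p (g := a ∘ g)) j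
  convert Matrix.det_mul_det_eq_sum (M.submatrix (Fin.castAdd n) id)
    (M.submatrix (Fin.natAdd n) id) hr using 2 with s hs
  rw [← hrows, ← hrows]
  unfold Function.extend
  congr!
end

section
/- Ciucu's Schur function identity: Let k ≥ 1 and let T = {t_1 < t_2 < … < t_{2k}} be a set of 2k positive integers. For a finite set S = {u_1 < u_2 < … < u_r} of nonnegative integers, let λ(S) denote the partition of length r whose parts are u_r − r + 1 ≥ … ≥ u_2 − 1 ≥ u_1, i.e. λ(S)_j = u_{r+1−j} − (r − j) for 1 ≤ j ≤ r. Then, in the polynomial ring of symmetric polynomials in N variables, Σ_{A ⊆ T, |A| = k} s_{λ(A)} · s_{λ(T∖A)} = 2^k · s_{λ({t_2, t_4, …, t_{2k}})} · s_{λ({t_1, t_3, …, t_{2k−1}})}. -/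
/-- The complete homogeneous symmetric polynomial of degree `m` in `N` variables
over `ℤ`, with `h 0 = 1` and `h m = 0` for `m < 0`. -/
noncomputable def hciz (N : ℕ) (m : ℤ) : MvPolynomial (Fin N) ℤ :=
  if 0 ≤ m then MvPolynomial.hsymm (Fin N) ℤ m.toNat else 0

/-- The Schur function of a finite integer sequence `μ = (μ 0, …, μ (r-1))`,
defined via the Jacobi–Trudi formula as the determinant of the `r × r` matrix
with `(i, j)` entry `h_{μ i − i + j}` (for the empty sequence this is `1`). -/
noncomputable def schur (N r : ℕ) (μ : Fin r → ℤ) : MvPolynomial (Fin N) ℤ :=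
  (Matrix.of fun i j : Fin r => hciz N (μ i - (i : ℕ) + (j : ℕ))).det

/-- For a finite set `S = {u_1 < u_2 < … < u_r}` of nonnegative integers,
`λ(S)` is the partition of length `r = S.card` whose parts are
`u_r − r + 1 ≥ … ≥ u_2 − 1 ≥ u_1`, i.e. the `j`-th part (`1`-indexed) is
`u_{r+1−j} − (r−j)`.  Here `S.orderIsoOfFin rfl` is the increasing enumeration
of `S` (`0`-indexed), and `j.rev = r − 1 − j`. -/
noncomputable def lamOf (S : Finset ℕ) : Fin S.card → ℤ :=
  fun j => ((S.orderIsoOfFin rfl j.rev : ℕ) : ℤ) - ((j.rev : ℕ) : ℤ)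

theorem card_filter_even {n k : ℕ} (hn : n = k + k) :
    (Finset.univ.filter fun i : Fin n => (i : ℕ) % 2 = 0).card = k := by
  subst hn
  have h : (Finset.univ.filter fun i : Fin (k + k) => (i : ℕ) % 2 = 0) =
      Finset.univ.image fun a : Fin k => (⟨2 * a, by omega⟩ : Fin (k + k)) := by
    ext i
    simp only [Finset.mem_filter, Finset.mem_univ, true_and, Finset.mem_image, Fin.ext_iff]
    exact ⟨fun h => ⟨⟨i / 2, by omega⟩, by dsimp only; omega⟩, fun ⟨a, ha⟩ => by omega⟩
  rw [h, Finset.card_image_of_injective, Finset.card_fin]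
  intro a b hab
  simpa [Fin.ext_iff] using hab

theorem card_filter_odd {n k : ℕ} (hn : n = k + k) :
    (Finset.univ.filter fun i : Fin n => (i : ℕ) % 2 = 1).card = k := by
  have h : (Finset.univ.filter fun i : Fin n => (i : ℕ) % 2 = 1) =
      (Finset.univ.filter fun i : Fin n => (i : ℕ) % 2 = 0)ᶜ := by
    ext i; simp
  rw [h, Finset.card_compl, card_filter_even hn, Fintype.card_fin]
  omega

open Finset in
/-- The sign of the shuffle listing `s` increasingly, followed by its complement, counts the
inversions between the complement and `s`. -/
theorem sign_finSumEquivOfFinset {p q : ℕ} (s : Finset (Fin (p + q))) (hs : s.card = p)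
    (hc : sᶜ.card = q) :
    Equiv.Perm.sign (finSumFinEquiv.symm.trans (finSumEquivOfFinset hs hc)) =
      ∏ a, ∏ b, if sᶜ.orderEmbOfFin hc b < s.orderEmbOfFin hs a then -1 else 1 := by
  have hne : ∀ a b, s.orderEmbOfFin hs a ≠ sᶜ.orderEmbOfFin hc b := fun a b h =>
    mem_compl.1 (sᶜ.orderEmbOfFin_mem hc b) (h ▸ s.orderEmbOfFin_mem hs a)
  rw [Equiv.Perm.sign_eq_prod_prod_Ioi]
  have hIoi : ∀ i : Fin (p + q), Ioi i = univ.filter (i < ·) := fun i => by ext; simp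
  simp only [hIoi, prod_filter, Fin.prod_univ_add, Equiv.trans_apply,
    finSumFinEquiv_symm_apply_castAdd, finSumFinEquiv_symm_apply_natAdd,
    finSumEquivOfFinset_inl, finSumEquivOfFinset_inr]
  have h₁ : ∀ a b : Fin p, (if Fin.castAdd q a < Fin.castAdd q b then
      if s.orderEmbOfFin hs a < s.orderEmbOfFin hs b then (1 : ℤˣ) else -1 else 1) = 1 := by
    intro a b
    split_ifs with h h'
    · rfl
    · exact absurd ((s.orderEmbOfFin hs).strictMono (show a < b from h)) h'
    · rfl
  have h₂ : ∀ a b : Fin q, (if Fin.natAdd p a < Fin.natAdd p b then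
      if sᶜ.orderEmbOfFin hc a < sᶜ.orderEmbOfFin hc b then (1 : ℤˣ) else -1 else 1) = 1 := by
    intro a b
    split_ifs with h h'
    · rfl
    · exact absurd ((sᶜ.orderEmbOfFin hc).strictMono ((Fin.natAdd_lt_natAdd_iff p).1 h)) h'
    · rfl
  have h₃ : ∀ (a : Fin q) (b : Fin p), ¬ Fin.natAdd p a < Fin.castAdd q b := by
    intro a b; simp [Fin.lt_def]; omega
  have h₄ : ∀ (a : Fin p) (b : Fin q), Fin.castAdd q a < Fin.natAdd p b := by
    intro a b; simp [Fin.lt_def]; omega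
  simp only [h₁, h₂, h₃, h₄, if_true, if_false, prod_const_one, mul_one, one_mul]
  refine prod_congr rfl fun a _ => prod_congr rfl fun b _ => ?_
  rcases lt_or_gt_of_ne (hne a b) with h | h
  · rw [if_pos h, if_neg h.not_gt]
  · rw [if_neg h.not_gt, if_pos h]

open Finset in
theorem prod_orderEmbOfFin {M : Type*} [CommMonoid M] {n p : ℕ} (s : Finset (Fin n))
    (hs : s.card = p) (f : Fin n → M) : ∏ a, f (s.orderEmbOfFin hs a) = ∏ i ∈ s, f i := by
  conv_rhs => rw [← s.image_orderEmbOfFin_univ hs]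
  rw [prod_image (s.orderEmbOfFin hs).injective.injOn]

open Finset in
/-- The shuffle sign is proportional to the alternating weight of `s`. -/
theorem sign_finSumEquivOfFinset_mul {p q : ℕ} (s : Finset (Fin (p + q))) (hs : s.card = p)
    (hc : sᶜ.card = q) :
    Equiv.Perm.sign (finSumFinEquiv.symm.trans (finSumEquivOfFinset hs hc)) *
      ∏ a : Fin p, ∏ b : Fin p, (if b < a then -1 else 1) =
      ∏ i ∈ s, (-1 : ℤˣ) ^ (i : ℕ) := by
  rw [sign_finSumEquivOfFinset, ← prod_mul_distrib, ← prod_orderEmbOfFin s hs]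
  refine prod_congr rfl fun a _ => ?_
  have key : ∀ i : Fin (p + q), ∏ j, (if j < i then (-1 : ℤˣ) else 1) = (-1) ^ (i : ℕ) := by
    intro i
    rw [prod_ite, prod_const_one, mul_one, prod_const]
    congr 1
    rw [show univ.filter (· < i) = Iio i by ext; simp, Fin.card_Iio]
  rw [← key, ← (finSumEquivOfFinset hs hc).prod_comp, Fintype.prod_sum_type, mul_comm]
  simp
  rfl

section Minor

variable {R : Type*} [CommRing R] {n p q : ℕ}

open Finset

/-- The maximal minor of `M` on the rows in `s`, taken in increasing order; it is `0` if `s` does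
not have as many elements as `M` has columns. -/
noncomputable def rowMinor (M : Matrix (Fin n) (Fin p) R) (s : Finset (Fin n)) : R :=
  if h : s.card = p then (M.submatrix (s.orderEmbOfFin h) id).det else 0

theorem rowMinor_of_card (M : Matrix (Fin n) (Fin p) R) {s : Finset (Fin n)} (h : s.card = p) :
    rowMinor M s = (M.submatrix (s.orderEmbOfFin h) id).det :=
  dif_pos h

/-- Scaling the rows of `M` scales its minors. -/
theorem rowMinor_mul_rows (M : Matrix (Fin n) (Fin p) R) (v : Fin n → R) (s : Finset (Fin n)) :
    rowMinor (Matrix.of fun i j => v i * M i j) s = (∏ i ∈ s, v i) * rowMinor M s := by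
  by_cases h : s.card = p
  · rw [rowMinor_of_card _ h, rowMinor_of_card _ h, ← prod_orderEmbOfFin s h,
      ← Matrix.det_mul_column]
    rfl
  · simp [rowMinor, h]

theorem det_submatrix_eq_sign_mul {m o : Type*} [Fintype m] [DecidableEq m] [Fintype o]
    [DecidableEq o] (e f : o ≃ m) (Z : Matrix m o R) :
    (Z.submatrix e id).det =
      Equiv.Perm.sign (f.symm.trans e) * (Z.submatrix id f.symm).det := by
  rw [← Matrix.det_permute, ← Matrix.det_submatrix_equiv_self f]
  congr 1
  ext i j
  simp

/-- A term of the Laplace expansion along the first `p` columns. -/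
theorem det_piecewise_elim (P : Matrix (Fin (p + q)) (Fin p) R) (Q : Matrix (Fin (p + q)) (Fin q) R)
    (s : Finset (Fin (p + q))) (hs : s.card = p) (hc : sᶜ.card = q) :
    ((Matrix.of (s.piecewise (fun i => Sum.elim (P i) 0) fun i => Sum.elim 0 (Q i))).submatrix id
        finSumFinEquiv.symm).det =
      Equiv.Perm.sign (finSumFinEquiv.symm.trans (finSumEquivOfFinset hs hc)) *
        (rowMinor P s * rowMinor Q sᶜ) := by
  set Z : Matrix (Fin (p + q)) (Fin p ⊕ Fin q) R :=
    Matrix.of (s.piecewise (fun i => Sum.elim (P i) 0) fun i => Sum.elim 0 (Q i)) with hZ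
  have h := det_submatrix_eq_sign_mul (finSumEquivOfFinset hs hc) finSumFinEquiv Z
  have hb : Z.submatrix (finSumEquivOfFinset hs hc) id =
      Matrix.fromBlocks (P.submatrix (s.orderEmbOfFin hs) id) 0 0
        (Q.submatrix (sᶜ.orderEmbOfFin hc) id) := by
    ext i j
    rcases i with a | b
    · have ha := s.orderEmbOfFin_mem hs a
      rcases j with j | j <;> simp [hZ, Finset.piecewise, ha]
    · have hb := mem_compl.1 (sᶜ.orderEmbOfFin_mem hc b)
      rcases j with j | j <;> simp [hZ, Finset.piecewise, hb]
  rw [hb, Matrix.det_fromBlocks_zero₂₁, ← rowMinor_of_card, ← rowMinor_of_card] at h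
  rw [h, ← mul_assoc, ← Int.cast_mul, ← Units.val_mul, Int.units_mul_self]
  simp

/-- **Laplace expansion** of a determinant along its first `p` columns. -/
theorem det_fromCols_eq_sum (P : Matrix (Fin (p + q)) (Fin p) R)
    (Q : Matrix (Fin (p + q)) (Fin q) R) (c : Finset (Fin (p + q)) → ℤˣ)
    (hcs : ∀ (s : Finset (Fin (p + q))) (hs : s.card = p) (hc : sᶜ.card = q),
      c s = Equiv.Perm.sign (finSumFinEquiv.symm.trans (finSumEquivOfFinset hs hc))) :
    ((Matrix.fromCols P Q).submatrix id finSumFinEquiv.symm).det =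
      ∑ s ∈ univ.filter (fun s : Finset (Fin (p + q)) => s.card = p),
        ((c s : ℤ) : R) * (rowMinor P s * rowMinor Q sᶜ) := by
  have hsplit : (Matrix.fromCols P Q).submatrix id finSumFinEquiv.symm =
      (fun i => (Sum.elim (P i) 0 : Fin p ⊕ Fin q → R) ∘ finSumFinEquiv.symm) +
        fun i => (Sum.elim 0 (Q i) : Fin p ⊕ Fin q → R) ∘ finSumFinEquiv.symm := by
    ext i j
    rcases h : finSumFinEquiv.symm j with a | a <;> simp [h]
  have hexp := (Matrix.detRowAlternating (R := R) (n := Fin (p + q))).map_add_univ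
    (fun i => (Sum.elim (P i) 0 : Fin p ⊕ Fin q → R) ∘ finSumFinEquiv.symm)
    (fun i => (Sum.elim 0 (Q i) : Fin p ⊕ Fin q → R) ∘ finSumFinEquiv.symm)
  rw [← hsplit] at hexp
  refine hexp.trans ?_
  rw [sum_filter]
  refine sum_congr rfl fun s _ => ?_
  have hpw : s.piecewise (fun i => (Sum.elim (P i) 0 : Fin p ⊕ Fin q → R) ∘ finSumFinEquiv.symm)
      (fun i => (Sum.elim 0 (Q i) : Fin p ⊕ Fin q → R) ∘ finSumFinEquiv.symm) =
      (Matrix.of (s.piecewise (fun i => Sum.elim (P i) 0) fun i => Sum.elim 0 (Q i))).submatrix id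
        finSumFinEquiv.symm := by
    ext i j
    by_cases hi : i ∈ s <;> simp [Finset.piecewise, hi]
  rw [hpw]
  split_ifs with hs
  · have hc : sᶜ.card = q := by simp [card_compl, hs]
    rw [hcs s hs hc, ← det_piecewise_elim]
    rfl
  · refine (Matrix.det_apply _).trans (sum_eq_zero fun σ _ => ?_)
    suffices h : ∃ i, ¬ ((σ i ∈ s) ↔ (finSumFinEquiv.symm i : Fin p ⊕ Fin q).isLeft) by
      obtain ⟨i, hi⟩ := h
      rw [prod_eq_zero (mem_univ i), smul_zero]
      rcases h : (finSumFinEquiv.symm i : Fin p ⊕ Fin q) with a | a <;>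
        simp [h] at hi <;> simp [Finset.piecewise, hi, h]
    by_contra! h
    apply hs
    calc s.card = (univ.image (fun a : Fin p => σ (Fin.castAdd q a))).card := by
          congr 1
          ext i
          obtain ⟨j, rfl⟩ := σ.surjective i
          rw [h j]
          induction j using Fin.addCases <;> simp [Fin.ext_iff]
          all_goals omega
      _ = p := by
          exact (card_image_of_injective _
            (σ.injective.comp (Fin.castAdd_injective p q))).trans (card_fin p)

theorem det_fromBlocks_neg {o : Type*} [Fintype o] [DecidableEq o] (A B : Matrix o o R) :
    (Matrix.fromBlocks A A B (-B)).det =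
      (-1) ^ Fintype.card o * (2 ^ Fintype.card o * A.det * B.det) := by
  have h : Matrix.fromBlocks A A B (-B) * Matrix.fromBlocks 1 (-1) 0 1 =
      Matrix.fromBlocks A 0 B ((-2 : R) • B) := by
    rw [Matrix.fromBlocks_multiply]
    congr 1 <;> simp
    module
  have := congrArg Matrix.det h
  rw [Matrix.det_mul, Matrix.det_fromBlocks_zero₂₁, Matrix.det_fromBlocks_zero₁₂,
    Matrix.det_smul] at this
  simp only [Matrix.det_one, mul_one] at this
  rw [this, show (-2 : R) = -1 * 2 by ring, mul_pow]
  ring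

/-- For a matrix with twice as many rows as columns, the sum of the products of complementary
maximal minors is `2 ^ k` times the product of the minors on the odd and on the even rows. -/
theorem sum_rowMinor_mul_rowMinor_compl {k : ℕ} (M : Matrix (Fin n) (Fin k) R) (hn : n = k + k) :
    ∑ s ∈ univ.filter (fun s : Finset (Fin n) => s.card = k), rowMinor M s * rowMinor M sᶜ =
      2 ^ k * rowMinor M (univ.filter fun i => (i : ℕ) % 2 = 1) *
        rowMinor M (univ.filter fun i => (i : ℕ) % 2 = 0) := by
  subst hn
  set E : Finset (Fin (k + k)) := univ.filter fun i => (i : ℕ) % 2 = 0 with hE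
  have hEc : univ.filter (fun i : Fin (k + k) => (i : ℕ) % 2 = 1) = Eᶜ := by
    ext i; simp [hE]
  have hEcard : E.card = k := card_filter_even rfl
  have hEccard : Eᶜ.card = k := by simp [card_compl, hEcard]
  have hoddE : ∀ i ∈ Eᶜ, Odd (i : ℕ) := fun i hi => Nat.odd_iff.2 (by simpa [hE] using hi)
  let w : ℤˣ := ∏ a : Fin k, ∏ b : Fin k, (if b < a then -1 else 1)
  let c : Finset (Fin (k + k)) → ℤˣ := fun s => w * ∏ i ∈ s, (-1 : ℤˣ) ^ (i : ℕ)
  have hcs : ∀ (s : Finset (Fin (k + k))) (hs : s.card = k) (hc : sᶜ.card = k),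
      c s = Equiv.Perm.sign (finSumFinEquiv.symm.trans (finSumEquivOfFinset hs hc)) := by
    intro s hs hc
    simp only [c, w]
    rw [← sign_finSumEquivOfFinset_mul s hs hc, mul_left_comm, Int.units_mul_self, mul_one]
  let Q : Matrix (Fin (k + k)) (Fin k) R := Matrix.of fun i j => (-1) ^ (i : ℕ) * M i j
  let C : ℤˣ := w * ∏ i : Fin (k + k), (-1 : ℤˣ) ^ (i : ℕ)
  have hC : ∀ s : Finset (Fin (k + k)),
      ((c s : ℤ) : R) * ∏ i ∈ sᶜ, (-1 : R) ^ (i : ℕ) = ((C : ℤ) : R) := by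
    intro s
    simp only [C, c]
    rw [← prod_mul_prod_compl s, ← mul_assoc]
    push_cast
    rfl
  have hsum := det_fromCols_eq_sum M Q c hcs
  simp only [Q, rowMinor_mul_rows M (fun i => (-1) ^ (i : ℕ))] at hsum
  have hterm : ∀ s : Finset (Fin (k + k)), ((c s : ℤ) : R) *
      (rowMinor M s * ((∏ i ∈ sᶜ, (-1) ^ (i : ℕ)) * rowMinor M sᶜ)) =
      ((C : ℤ) : R) * (rowMinor M s * rowMinor M sᶜ) := fun s => by rw [← hC s]; ring
  simp only [hterm, ← mul_sum] at hsum
  have hdet := det_submatrix_eq_sign_mul (finSumEquivOfFinset hEcard hEccard) finSumFinEquiv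
    (Matrix.fromCols M Q)
  have hblocks : (Matrix.fromCols M Q).submatrix (finSumEquivOfFinset hEcard hEccard) id =
      Matrix.fromBlocks (M.submatrix (E.orderEmbOfFin hEcard) id)
        (M.submatrix (E.orderEmbOfFin hEcard) id) (M.submatrix (Eᶜ.orderEmbOfFin hEccard) id)
        (-M.submatrix (Eᶜ.orderEmbOfFin hEccard) id) := by
    ext i j
    rcases i with a | b
    · have ha : Even (E.orderEmbOfFin hEcard a : ℕ) :=
        Nat.even_iff.2 (mem_filter.1 (E.orderEmbOfFin_mem hEcard a)).2
      rcases j with j | j <;> simp [Q, ha.neg_one_pow]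
    · have hb : Odd (Eᶜ.orderEmbOfFin hEccard b : ℕ) :=
        hoddE _ (Eᶜ.orderEmbOfFin_mem hEccard b)
      rcases j with j | j <;> simp [Q, hb.neg_one_pow]
  have hodd : ∏ i ∈ Eᶜ, (-1 : R) ^ (i : ℕ) = (-1) ^ k := by
    rw [prod_congr rfl (g := fun _ => (-1 : R)), prod_const, hEccard]
    intro i hi
    exact (hoddE i hi).neg_one_pow
  rw [hblocks, det_fromBlocks_neg, ← rowMinor_of_card, ← rowMinor_of_card, Fintype.card_fin,
    ← hcs, hsum, ← hodd] at hdet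
  have hc : ∀ u : ℤˣ, ((u : ℤ) : R) * ((u : ℤ) : R) = 1 := fun u => by
    rw [← Int.cast_mul, ← Units.val_mul, Int.units_mul_self]; simp
  have hfin : ((C : ℤ) : R) * (2 ^ k * rowMinor M E * rowMinor M Eᶜ) = ((C : ℤ) : R) *
      ∑ s ∈ univ.filter (fun s : Finset (Fin (k + k)) => s.card = k),
        rowMinor M s * rowMinor M sᶜ := by
    rw [← hC E, mul_assoc, hdet, hC E, ← mul_assoc, hc, one_mul]
  rw [hEc]
  linear_combination (-((C : ℤ) : R)) * hfin + (2 ^ k * rowMinor M E * rowMinor M Eᶜ -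
    ∑ s ∈ univ.filter (fun s : Finset (Fin (k + k)) => s.card = k),
        rowMinor M s * rowMinor M sᶜ) * hc C

end Minor

open Finset in
/-- Up to reversing the order of the rows, the Schur function of `λ(t(s))` is a maximal minor of a
matrix of complete homogeneous symmetric polynomials. -/
theorem schur_lamOf_image (N : ℕ) {n k : ℕ} (t : Fin n → ℕ) (ht : StrictMono t)
    (s : Finset (Fin n)) (hs : s.card = k) :
    schur N (s.image t).card (lamOf (s.image t)) =
      Equiv.Perm.sign (Fin.revPerm : Equiv.Perm (Fin k)) *
        rowMinor (Matrix.of fun (i : Fin n) (j : Fin k) =>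
          hciz N ((t i : ℤ) + 1 - k + (j : ℕ))) s := by
  have hcard : (s.image t).card = k := by rw [card_image_of_injective _ ht.injective, hs]
  have hemb : t ∘ s.orderEmbOfFin hs = (s.image t).orderEmbOfFin hcard :=
    orderEmbOfFin_unique hcard (fun i => mem_image_of_mem t (s.orderEmbOfFin_mem hs i))
      (ht.comp (s.orderEmbOfFin hs).strictMono)
  rw [rowMinor_of_card _ hs, ← Matrix.det_permute, schur]
  generalize s.image t = S at hcard hemb
  subst hcard
  congr 1
  refine Matrix.ext fun i j => ?_
  have hi : t (s.orderEmbOfFin hs (Fin.rev i)) = S.orderIsoOfFin rfl (Fin.rev i) :=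
    congrFun hemb (Fin.rev i)
  simp only [Matrix.of_apply, Matrix.submatrix_apply, Fin.revPerm_apply, id, lamOf, hi]
  congr 1
  have := Fin.val_rev i
  have := i.isLt
  omega

/-- **Ciucu's Schur function identity.**  For a set `T = {t_1 < t_2 < … < t_{2k}}`
of `2k` positive integers (here `t : Fin (2k) → ℕ` strictly increasing, so that
subsets of `T` correspond to images under `t` of subsets of the index set):
`Σ_{A ⊆ T, |A| = k} s_{λ(A)} · s_{λ(T∖A)}
  = 2^k · s_{λ({t_2, t_4, …, t_{2k}})} · s_{λ({t_1, t_3, …, t_{2k−1}})}`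
(indices of `t` written `1`-indexed; `i % 2 = 1` below selects the `0`-indexed
odd positions `t_2, t_4, …`). -/
theorem ciucu_schur_identity (N : ℕ) (hN : 1 ≤ N) (k : ℕ) (hk : 1 ≤ k)
    (t : Fin (2 * k) → ℕ) (ht : StrictMono t) (htpos : ∀ i, 1 ≤ t i) :
    ∑ A ∈ Finset.univ.filter (fun A : Finset (Fin (2 * k)) => A.card = k),
        schur N (A.image t).card (lamOf (A.image t)) *
          schur N (Aᶜ.image t).card (lamOf (Aᶜ.image t))
    = 2 ^ k *
        schur N ((Finset.univ.filter (fun i : Fin (2 * k) => (i : ℕ) % 2 = 1)).image t).card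
          (lamOf ((Finset.univ.filter (fun i : Fin (2 * k) => (i : ℕ) % 2 = 1)).image t)) *
        schur N ((Finset.univ.filter (fun i : Fin (2 * k) => (i : ℕ) % 2 = 0)).image t).card
          (lamOf ((Finset.univ.filter (fun i : Fin (2 * k) => (i : ℕ) % 2 = 0)).image t)) := by
  have hn : 2 * k = k + k := two_mul k
  set M : Matrix (Fin (2 * k)) (Fin k) (MvPolynomial (Fin N) ℤ) :=
    Matrix.of fun i j => hciz N ((t i : ℤ) + 1 - k + (j : ℕ))
  have hsq : ∀ x y : MvPolynomial (Fin N) ℤ,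
      (((Equiv.Perm.sign (Fin.revPerm : Equiv.Perm (Fin k)) : ℤ) : MvPolynomial (Fin N) ℤ) * x) *
      (((Equiv.Perm.sign (Fin.revPerm : Equiv.Perm (Fin k)) : ℤ) : MvPolynomial (Fin N) ℤ) * y) =
      x * y := fun x y => by
    rw [mul_mul_mul_comm, ← Int.cast_mul, ← Units.val_mul, Int.units_mul_self]
    simp
  have heven := card_filter_even hn
  have hodd := card_filter_odd hn
  rw [mul_assoc, schur_lamOf_image N t ht _ heven, schur_lamOf_image N t ht _ hodd, hsq,
    ← mul_assoc, ← sum_rowMinor_mul_rowMinor_compl M hn]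
  refine Finset.sum_congr rfl fun A hA => ?_
  have hA : A.card = k := (Finset.mem_filter.1 hA).2
  have hAc : Aᶜ.card = k := by rw [Finset.card_compl, Fintype.card_fin, hA]; omega
  rw [schur_lamOf_image N t ht _ hA, schur_lamOf_image N t ht _ hAc, hsq]
end

section
/- Kleber's theorem: Let n ≥ 1 and let λ be a partition with n outside corners, encoded by integers x_1 > x_2 > … > x_n > 0 (the distinct part sizes of λ) and 0 = y_0 < y_1 < y_2 < … < y_n (y_i being the number of parts of λ that are ≥ x_i), so that λ = (x_1^{y_1−y_0}, x_2^{y_2−y_1}, …, x_n^{y_n−y_{n−1}}). Fix an integer k with 1 ≤ k ≤ n and set l = y_k. Define λ + ω_l (resp. λ − ω_l) as the partition obtained from corner data (x, y) by adding 1 to (resp. subtracting 1 from) each of x_1, …, x_k. For 1 ≤ i ≤ j ≤ n, define π^i_j (resp. μ^i_j) as the operation on corner data adding 1 to (resp. subtracting 1 from) each of x_{i+1},…,x_j and y_i,…,y_j, and for 1 ≤ i_1 < … < i_m ≤ j_m < … < j_1 ≤ n set π^{i_1,…,i_m}_{j_1,…,j_m} = π^{i_1}_{j_1} ∘ … ∘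 π^{i_m}_{j_m} and μ^{i_1,…,i_m}_{j_1,…,j_m} = μ^{i_1}_{j_1} ∘ … ∘ μ^{i_m}_{j_m}, reading the resulting corner data (x′, y′) as the weakly decreasing sequence having y′_t − y′_{t−1} parts equal to x′_t for t = 1,…,n (with y′_0 = 0). Then, in the polynomial ring of symmetric polynomials in N variables, s_λ · s_λ = s_{λ+ω_l} · s_{λ−ω_l} + Σ_{m ≥ 1} Σ_{1 ≤ i_1 < … < i_m ≤ k, k ≤ j_m < … < j_1 ≤ n} (−1)^{m−1} · s_{π^{i_1,…,i_m}_{j_1,…,j_m}(λ)} · s_{μ^{i_1,…,i_m}_{j_1,…,j_m}(λ)}. -/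
open scoped Classical

/-- Corner data for a partition with `n` distinct part sizes: the distinct part
sizes `x = (x_1, …, x_n)` (stored `0`-indexed, so `x ⟨t-1⟩` is `x_t`) and the
corner heights `y = (y_0, y_1, …, y_n)` (stored so that `y q` is `y_q`). -/
abbrev CornerData (n : ℕ) := (Fin n → ℤ) × (Fin (n + 1) → ℤ)

/-- The operation `π^i_j` (`1 ≤ i ≤ j ≤ n`, both `1`-indexed) on corner data:
add `1` to each of `x_{i+1}, …, x_j` and `y_i, …, y_j`. -/
def piOp {n : ℕ} (i j : ℕ) (d : CornerData n) : CornerData n :=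
  (fun p => if i ≤ (p : ℕ) ∧ (p : ℕ) + 1 ≤ j then d.1 p + 1 else d.1 p,
   fun q => if i ≤ (q : ℕ) ∧ (q : ℕ) ≤ j then d.2 q + 1 else d.2 q)

/-- The operation `μ^i_j` (`1 ≤ i ≤ j ≤ n`, both `1`-indexed) on corner data:
subtract `1` from each of `x_{i+1}, …, x_j` and `y_i, …, y_j`. -/
def muOp {n : ℕ} (i j : ℕ) (d : CornerData n) : CornerData n :=
  (fun p => if i ≤ (p : ℕ) ∧ (p : ℕ) + 1 ≤ j then d.1 p - 1 else d.1 p,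
   fun q => if i ≤ (q : ℕ) ∧ (q : ℕ) ≤ j then d.2 q - 1 else d.2 q)

/-- The composition `g_1 ∘ g_2 ∘ … ∘ g_m` of a finite sequence of operations. -/
def opComp {n : ℕ} (m : ℕ) (g : Fin m → CornerData n → CornerData n) :
    CornerData n → CornerData n :=
  (List.ofFn g).foldr (· ∘ ·) id

/-- Reading corner data `(x, y)` back as a partition: the weakly decreasing
sequence of length `(y_n).toNat` having `y_t − y_{t−1}` parts equal to `x_t`
for `t = 1, …, n`; the part at (`0`-indexed) position `p` is `x_t` for the least
(`1`-indexed) `t` with `p < y_t`, and (for weakly increasing `y`) the number of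
`q ∈ {1, …, n}` with `y_q ≤ p` equals `t − 1`. -/
noncomputable def partsOf {n : ℕ} (d : CornerData n) :
    Fin (d.2 (Fin.last n)).toNat → ℤ :=
  fun p =>
    if h : (Finset.univ.filter fun q : Fin n => d.2 q.succ ≤ ((p : ℕ) : ℤ)).card < n
    then d.1 ⟨_, h⟩ else 0

/-- The Schur function attached to corner data, of length `(y_n).toNat`. -/
noncomputable def schurOf (N : ℕ) {n : ℕ} (d : CornerData n) :
    MvPolynomial (Fin N) ℤ :=
  schur N (d.2 (Fin.last n)).toNat (partsOf d)

section Exchange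

open Function

variable {A ι κ : Type*}

lemma Function.Injective.extend_update [DecidableEq ι] [DecidableEq κ] {f : κ → ι}
    (hf : Injective f) (g : κ → A) (e : ι → A) (t : κ) (v : A) :
    extend f (update g t v) e = update (extend f g e) (f t) v := by
  ext p
  by_cases hp : ∃ s, f s = p
  · obtain ⟨s, rfl⟩ := hp
    by_cases hs : s = t
    · subst hs; simp [hf.extend_apply]
    · simp [hf.extend_apply, hs, hf.ne hs]
  · rw [extend_apply' _ _ _ hp, update_of_ne (fun h => hp ⟨t, h.symm⟩), extend_apply' _ _ _ hp]

lemma extend_comp_self (f : κ → ι) (M : ι → A) : extend f (M ∘ f) M = M := by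
  ext p
  by_cases hp : ∃ s, f s = p
  · obtain ⟨s, rfl⟩ := hp
    exact FactorsThrough.extend_apply (fun a b h => by simp [h]) _ _
  · exact extend_apply' _ _ _ hp

variable [CommRing A] [Fintype ι] [DecidableEq ι]

/-- The determinant of the matrix with the given rows. -/
def rowDet (M : ι → ι → A) : A := (Matrix.of M).det

lemma rowDet_eq_zero {M : ι → ι → A} {p q : ι} (hpq : p ≠ q) (h : M p = M q) : rowDet M = 0 :=
  Matrix.det_zero_of_row_eq hpq h

lemma rowDet_comp_perm (M : ι → ι → A) (σ : Equiv.Perm ι) :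
    rowDet (M ∘ σ) = Equiv.Perm.sign σ * rowDet M :=
  Matrix.det_permute σ (Matrix.of M)

/-- The determinant of `M` as an alternating function of the rows at the positions `f`. -/
noncomputable def detOfRows (M : ι → ι → A) (f : κ → ι) (hf : Injective f) :
    (ι → A) [⋀^κ]→ₗ[A] A where
  toFun Q := rowDet (extend f Q M)
  map_update_add' Q t a b := by
    simp only [hf.extend_update]
    exact Matrix.det_updateRow_add (Matrix.of _) _ _ _
  map_update_smul' Q t c a := by
    simp only [hf.extend_update]
    exact Matrix.det_updateRow_smul (Matrix.of _) _ _ _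
  map_eq_zero_of_eq' Q s t hQ hst := by
    refine rowDet_eq_zero (hf.ne hst) ?_
    rw [hf.extend_apply, hf.extend_apply, hQ]

lemma detOfRows_apply (M : ι → ι → A) (f : κ → ι) (hf : Injective f) (Q : κ → ι → A) :
    detOfRows M f hf Q = rowDet (extend f Q M) := rfl

variable [Fintype κ]

/-- Alternating maps agree as soon as they agree on the rows of a matrix with nonzero
determinant. -/
lemma AlternatingMap.eq_of_eq_on_rows [IsDomain A] {T : ι → ι → A} (hT : rowDet T ≠ 0)
    (f g : (ι → A) [⋀^κ]→ₗ[A] A)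
    (h : ∀ u : κ → ι, Injective u → f (fun t => T (u t)) = g (fun t => T (u t))) : f = g := by
  obtain ⟨T, rfl⟩ : ∃ T' : Matrix ι ι A, T = fun i j => T' i j := ⟨Matrix.of T, rfl⟩
  change T.det ≠ 0 at hT
  have key : f.compLinearMap T.vecMulLinear = g.compLinearMap T.vecMulLinear := by
    refine Module.Basis.ext_alternating (Pi.basisFun A ι) fun u hu => ?_
    simpa [AlternatingMap.compLinearMap_apply, Matrix.row] using h u hu
  ext Q
  have h1 := DFunLike.congr_fun key (fun t => Matrix.vecMul (Q t) T.adjugate)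
  have h2 : (fun t => Matrix.vecMul (Matrix.vecMul (Q t) T.adjugate) T)
      = fun t => (fun _ : κ => T.det) t • Q t := by
    ext1 t
    rw [Matrix.vecMul_vecMul, Matrix.adjugate_mul, Matrix.vecMul_smul, Matrix.vecMul_one]
  simp only [AlternatingMap.compLinearMap_apply, Matrix.vecMulLinear_apply] at h1
  rw [h2, AlternatingMap.map_smul_univ, AlternatingMap.map_smul_univ] at h1
  exact smul_right_injective _ (Finset.prod_ne_zero_iff.2 fun _ _ => hT) h1

variable {β : Type*}

lemma det_extend_mul_det_of_det_ne_zero [IsDomain A] {M T : ι → ι → A} (hT : rowDet T ≠ 0)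
    {Y : Set ι} (hMT : ∀ p ∉ Y, M p = T p) {f : κ → ι} (hf : Injective f) (hfY : ∀ t, f t ∈ Y)
    (Q : κ → ι → A) (W : Finset β) (w : β → κ → ι) (hw : ∀ b ∈ W, Injective (w b))
    (hwY : ∀ b ∈ W, ∀ t, w b t ∈ Y)
    (hex : ∀ u : κ → ι, Injective u → (∀ t, u t ∈ Y) →
      ∃ b ∈ W, Set.range u = Set.range (w b))
    (huniq : ∀ b ∈ W, ∀ c ∈ W, Set.range (w b) = Set.range (w c) → b = c) :
    rowDet (extend f Q M) * rowDet T =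
      ∑ b ∈ W, rowDet (extend f (T ∘ w b) M) *
        rowDet (extend (w b) Q T) := by
  classical
  let G : (ι → A) [⋀^κ]→ₗ[A] A := ∑ b : W, detOfRows M f hf (T ∘ w b) •
    detOfRows T (w b) (hw b b.2)
  have hG : ∀ Q, G Q = ∑ b ∈ W, rowDet (extend f (T ∘ w b) M) *
        rowDet (extend (w b) Q T) := by
    intro Q
    rw [← Finset.sum_coe_sort W]
    let ev : (ι → A) [⋀^κ]→ₗ[A] A →+ A :=
      { toFun := fun g => g Q, map_zero' := rfl, map_add' := fun _ _ => rfl }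
    exact map_sum ev _ _
  have key : rowDet T • detOfRows M f hf = G := by
    refine AlternatingMap.eq_of_eq_on_rows hT _ _ fun u hu => ?_
    have hzero : ∀ b ∈ W, (∃ t, u t ∉ Set.range (w b)) →
        rowDet (extend (w b) (fun t => T (u t)) T) = 0 := by
      rintro b hb ⟨t, ht⟩
      refine rowDet_eq_zero (p := u t) (q := w b t) (fun h => ht ⟨t, h.symm⟩) ?_
      rw [(hw b hb).extend_apply, extend_apply' _ _ _ (by simpa using ht)]
    rw [hG]
    by_cases huY : ∀ t, u t ∈ Y
    · obtain ⟨b, hb, hub⟩ := hex u hu huY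
      rw [Finset.sum_eq_single_of_mem b hb]
      · let σ : Equiv.Perm κ := (Equiv.ofInjective u hu).trans
          ((Equiv.setCongr hub).trans (Equiv.ofInjective (w b) (hw b hb)).symm)
        have hσ : ∀ t, u t = w b (σ t) := by
          intro t
          have := Equiv.apply_ofInjective_symm (hw b hb) ⟨u t, hub ▸ ⟨t, rfl⟩⟩
          exact this.symm
        have e1 : (fun t => T (u t)) = fun t => (T ∘ w b) (σ t) := by
          ext1 t; simp [hσ]
        rw [← detOfRows_apply T (w b) (hw b hb), e1, AlternatingMap.smul_apply]
        have e2 := AlternatingMap.map_perm (detOfRows T (w b) (hw b hb)) (T ∘ w b) σ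
        have e3 := AlternatingMap.map_perm (detOfRows M f hf) (T ∘ w b) σ
        simp only [comp_def] at e2 e3 ⊢
        rw [e2, e3, ← detOfRows_apply M f hf]
        have e4 : detOfRows T (w b) (hw b hb) (fun t => T (w b t)) = rowDet T := by
          rw [detOfRows_apply]
          exact congrArg rowDet (extend_comp_self (w b) T)
        rw [e4]
        simp only [smul_eq_mul, Units.smul_def, zsmul_eq_mul]
        ring
      · intro c hc hcb
        rw [hzero c hc, mul_zero]
        by_contra! hcon
        apply hcb
        refine huniq c hc b hb ?_
        rw [← hub]
        have hsub : Finset.univ.image u ⊆ Finset.univ.image (w c) := by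
          intro p hp
          obtain ⟨t, -, rfl⟩ := Finset.mem_image.1 hp
          obtain ⟨s, hs⟩ := hcon t
          exact Finset.mem_image.2 ⟨s, Finset.mem_univ _, hs⟩
        have := Finset.eq_of_subset_of_card_le hsub (by
          rw [Finset.card_image_of_injective _ hu, Finset.card_image_of_injective _ (hw c hc)])
        simpa using (congrArg (fun s : Finset ι => (s : Set ι)) this).symm
    · obtain ⟨t, ht⟩ := not_forall.1 huY
      rw [Finset.sum_eq_zero, AlternatingMap.smul_apply, detOfRows_apply,
        rowDet_eq_zero (M := extend f _ M) (p := u t) (q := f t) (fun h => ht (by rw [h]; exact hfY t)), smul_zero]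
      · rw [hf.extend_apply, extend_apply' _ _ _ (fun ⟨s, hs⟩ => ht (hs ▸ hfY s)), hMT _ ht]
      · intro b hb
        rw [hzero b hb ⟨t, fun ⟨s, hs⟩ => ht (hs ▸ hwY b hb s)⟩, mul_zero]
  rw [← hG, ← key, AlternatingMap.smul_apply, detOfRows_apply, smul_eq_mul, mul_comm]

open Polynomial in
/-- The exchange form of the Plücker relations. The matrices `M` and `T` agree outside of the rows
in `Y`, and `w` enumerates each subset of `Y` of the size of `κ` exactly once. -/
theorem det_extend_mul_det [IsDomain A] {M T : ι → ι → A}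
    {Y : Set ι} (hMT : ∀ p ∉ Y, M p = T p) {f : κ → ι} (hf : Injective f) (hfY : ∀ t, f t ∈ Y)
    (Q : κ → ι → A) (W : Finset β) (w : β → κ → ι) (hw : ∀ b ∈ W, Injective (w b))
    (hwY : ∀ b ∈ W, ∀ t, w b t ∈ Y)
    (hex : ∀ u : κ → ι, Injective u → (∀ t, u t ∈ Y) →
      ∃ b ∈ W, Set.range u = Set.range (w b))
    (huniq : ∀ b ∈ W, ∀ c ∈ W, Set.range (w b) = Set.range (w c) → b = c) :
    rowDet (extend f Q M) * rowDet T =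
      ∑ b ∈ W, rowDet (extend f (T ∘ w b) M) *
        rowDet (extend (w b) Q T) := by
  classical
  let M' : ι → ι → A[X] := fun p q =>
    if p ∈ Y then C (M p q) else C (M p q) + (if p = q then X else 0)
  let T' : ι → ι → A[X] := fun p q => C (T p q) + (if p = q then X else 0)
  let Q' : κ → ι → A[X] := fun t q => C (Q t q)
  have hT' : rowDet T' ≠ 0 := by
    have : Matrix.of T' = (-Matrix.of T).charmatrix := by
      ext1 p q
      rw [Matrix.charmatrix_apply, Matrix.diagonal_apply]
      simp [T', add_comm]
    rw [rowDet, this]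
    exact (Matrix.charpoly_monic (-Matrix.of T)).ne_zero
  have hM'T' : ∀ p ∉ Y, M' p = T' p := by
    intro p hp
    ext1 q
    simp [M', T', hp, hMT p hp]
  let φ : A[X] →+* A := evalRingHom 0
  have hφX : φ X = 0 := by simp [φ]
  have hφC : ∀ a, φ (C a) = a := by simp [φ]
  have hdet : ∀ (N' : ι → ι → A[X]) (N : ι → ι → A), (∀ p q, φ (N' p q) = N p q) →
      φ (rowDet N') = rowDet N := by
    intro N' N h
    rw [rowDet, RingHom.map_det]
    congr 1
    ext p q
    exact h p q
  have hφM : ∀ p q, φ (M' p q) = M p q := by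
    intro p q
    simp only [M']
    split_ifs <;> simp [hφX, hφC]
  have hφT : ∀ p q, φ (T' p q) = T p q := by
    intro p q
    simp only [T']
    split_ifs <;> simp [hφX, hφC]
  have hext : ∀ (g : κ → ι) (R' : κ → ι → A[X]) (R : κ → ι → A) (N' : ι → ι → A[X])
      (N : ι → ι → A), Injective g → (∀ t q, φ (R' t q) = R t q) → (∀ p q, φ (N' p q) = N p q) →
      φ (rowDet (extend g R' N')) =
        rowDet (extend g R N) := by
    intro g R' R N' N hg hR hN
    refine hdet _ _ fun p q => ?_
    by_cases hp : ∃ s, g s = p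
    · obtain ⟨s, rfl⟩ := hp
      rw [hg.extend_apply, hg.extend_apply, hR]
    · rw [extend_apply' _ _ _ hp, extend_apply' _ _ _ hp, hN]
  have := congrArg φ (det_extend_mul_det_of_det_ne_zero hT' hM'T' hf hfY Q' W w hw hwY hex huniq)
  rw [map_mul, hext f Q' Q M' M hf (fun _ _ => hφC _) hφM, hdet T' T hφT, map_sum] at this
  rw [this]
  refine Finset.sum_congr rfl fun b hb => ?_
  rw [map_mul, hext f (T' ∘ w b) (T ∘ w b) M' M hf (fun _ _ => hφT _ _) hφM,
    hext (w b) Q' Q T' T (hw b hb) (fun _ _ => hφC _) hφT]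

/-- Exchanging `m` disjoint pairs of rows multiplies the determinant by `(-1) ^ m`. -/
lemma det_extend_exchange (M : ι → ι → A) (f : κ ⊕ κ → ι) (hf : Injective f) :
    rowDet (extend f (M ∘ f ∘ Sum.swap) M) =
      (-1) ^ Fintype.card κ * rowDet M := by
  classical
  let g : κ × Bool ↪ ι := (Equiv.prodComm _ _).toEmbedding.trans
    ((Equiv.boolProdEquivSum κ).toEmbedding.trans ⟨f, hf⟩)
  let σ : Equiv.Perm ι :=
    Equiv.Perm.viaFintypeEmbedding (Equiv.prodCongrRight fun _ : κ => Equiv.swap true false) g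
  have hσ : Equiv.Perm.sign σ = (-1) ^ Fintype.card κ := by
    rw [Equiv.Perm.viaFintypeEmbedding_sign, Equiv.Perm.sign_prodCongrRight]
    simp
  have hg : ∀ a b, g (a, b) = f (bif b then Sum.inr a else Sum.inl a) := by
    rintro a (_ | _) <;> rfl
  have hM : extend f (M ∘ f ∘ Sum.swap) M = M ∘ σ := by
    ext1 p
    by_cases hp : ∃ s, f s = p
    · obtain ⟨s, rfl⟩ := hp
      rw [hf.extend_apply, comp_apply]
      rcases s with a | a
      · have := Equiv.Perm.viaFintypeEmbedding_apply_image
          (Equiv.prodCongrRight (fun _ : κ => Equiv.swap true false)) g (a, false)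
        simp only [hg, Equiv.prodCongrRight_apply, Equiv.swap_apply_right, cond_true,
          cond_false] at this
        simp [σ, this]
      · have := Equiv.Perm.viaFintypeEmbedding_apply_image
          (Equiv.prodCongrRight (fun _ : κ => Equiv.swap true false)) g (a, true)
        simp only [hg, Equiv.prodCongrRight_apply, Equiv.swap_apply_left, cond_true,
          cond_false] at this
        simp [σ, this]
    · rw [extend_apply' _ _ _ hp, comp_apply,
        Equiv.Perm.viaFintypeEmbedding_apply_notMem_range]
      rintro ⟨⟨a, b⟩, h⟩
      exact hp ⟨_, (hg a b).symm.trans h⟩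
  rw [hM, rowDet_comp_perm, hσ]
  simp

end Exchange

section Nested

open Function

/-- The pairs of index sequences `i_1 < … < i_m < k` and `j_1 > … > j_m ≥ k - 1` (`0`-indexed). -/
noncomputable def nestedPairs (n k m : ℕ) : Finset ((Fin m → Fin n) × (Fin m → Fin n)) :=
  Finset.univ.filter fun ij => StrictMono ij.1 ∧ StrictAnti ij.2 ∧
    (∀ t, (ij.1 t : ℕ) + 1 ≤ k) ∧ (∀ t, k ≤ (ij.2 t : ℕ) + 1)

variable {n k : ℕ} (hkn : k ≤ n)

/-- The `k`-element subset of `{0, …, n}` obtained from `{0, …, k - 1}` by replacing each `i_s`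
by `j_s + 1`. -/
noncomputable def exchanged {m : ℕ} (ij : (Fin m → Fin n) × (Fin m → Fin n)) (t : Fin k) :
    Fin (n + 1) :=
  extend ij.1 (Fin.succ ∘ ij.2) Fin.castSucc (Fin.castLE hkn t)

lemma mem_nestedPairs {m : ℕ} {ij : (Fin m → Fin n) × (Fin m → Fin n)} :
    ij ∈ nestedPairs n k m ↔ StrictMono ij.1 ∧ StrictAnti ij.2 ∧
      (∀ t, (ij.1 t : ℕ) + 1 ≤ k) ∧ (∀ t, k ≤ (ij.2 t : ℕ) + 1) := by
  simp [nestedPairs]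

variable {m : ℕ} {ij : (Fin m → Fin n) × (Fin m → Fin n)}

lemma exchanged_of_eq (h : ij ∈ nestedPairs n k m) {t : Fin k} {s : Fin m}
    (hs : ij.1 s = Fin.castLE hkn t) : exchanged hkn ij t = (ij.2 s).succ := by
  rw [exchanged, ← hs, (mem_nestedPairs.1 h).1.injective.extend_apply, comp_apply]

lemma exchanged_of_notMem {t : Fin k} (ht : ¬ ∃ s, ij.1 s = Fin.castLE hkn t) :
    exchanged hkn ij t = (Fin.castLE hkn t).castSucc := by
  rw [exchanged, extend_apply' _ _ _ ht]

lemma exchanged_injective (h : ij ∈ nestedPairs n k m) : Injective (exchanged hkn ij) := by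
  obtain ⟨h1, h2, h3, h4⟩ := mem_nestedPairs.1 h
  intro a b hab
  by_cases ha : ∃ s, ij.1 s = Fin.castLE hkn a <;> by_cases hb : ∃ s, ij.1 s = Fin.castLE hkn b
  · obtain ⟨s, hs⟩ := ha
    obtain ⟨s', hs'⟩ := hb
    rw [exchanged_of_eq hkn h hs, exchanged_of_eq hkn h hs', Fin.succ_inj] at hab
    rw [h2.injective hab, hs'] at hs
    exact (Fin.castLE_injective hkn hs).symm
  · obtain ⟨s, hs⟩ := ha
    rw [exchanged_of_eq hkn h hs, exchanged_of_notMem hkn hb, Fin.ext_iff] at hab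
    have := h4 s
    simp at hab
    omega
  · obtain ⟨s, hs⟩ := hb
    rw [exchanged_of_eq hkn h hs, exchanged_of_notMem hkn ha, Fin.ext_iff] at hab
    have := h4 s
    simp at hab
    omega
  · rw [exchanged_of_notMem hkn ha, exchanged_of_notMem hkn hb] at hab
    exact Fin.castLE_injective hkn (Fin.castSucc_injective _ hab)

lemma castSucc_mem_range_exchanged (h : ij ∈ nestedPairs n k m) {t : Fin n} (ht : (t : ℕ) < k) :
    t.castSucc ∈ Set.range (exchanged hkn ij) ↔ t ∉ Set.range ij.1 := by
  obtain ⟨h1, h2, h3, h4⟩ := mem_nestedPairs.1 h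
  constructor
  · rintro ⟨a, ha⟩ ⟨s, hs⟩
    by_cases hc : ∃ s, ij.1 s = Fin.castLE hkn a
    · obtain ⟨s', hs'⟩ := hc
      rw [exchanged_of_eq hkn h hs', Fin.ext_iff] at ha
      have := h4 s'
      simp at ha
      omega
    · rw [exchanged_of_notMem hkn hc, Fin.castSucc_inj] at ha
      exact hc ⟨s, hs.trans ha.symm⟩
  · intro hc
    refine ⟨⟨t, ht⟩, ?_⟩
    rw [exchanged_of_notMem hkn (by simpa using hc)]
    rfl

lemma succ_mem_range_exchanged (h : ij ∈ nestedPairs n k m) {t : Fin n} (ht : k ≤ (t : ℕ) + 1) :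
    t.succ ∈ Set.range (exchanged hkn ij) ↔ t ∈ Set.range ij.2 := by
  obtain ⟨h1, h2, h3, h4⟩ := mem_nestedPairs.1 h
  constructor
  · rintro ⟨a, ha⟩
    by_cases hc : ∃ s, ij.1 s = Fin.castLE hkn a
    · obtain ⟨s, hs⟩ := hc
      rw [exchanged_of_eq hkn h hs, Fin.succ_inj] at ha
      exact ⟨s, ha⟩
    · rw [exchanged_of_notMem hkn hc, Fin.ext_iff] at ha
      simp at ha
      omega
  · rintro ⟨s, hs⟩
    exact ⟨⟨ij.1 s, h3 s⟩, by rw [exchanged_of_eq hkn h (s := s) rfl, hs]⟩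

lemma exists_range_exchanged_eq (hk : 1 ≤ k) (u : Fin k → Fin (n + 1)) (hu : Injective u) :
    ∃ m ≤ n, ∃ ij ∈ nestedPairs n k m, Set.range u = Set.range (exchanged hkn ij) := by
  let S := Finset.univ.image u
  have hS : ∀ q, q ∈ S ↔ q ∈ Set.range u := by simp [S]
  let I : Finset (Fin n) := Finset.univ.filter fun t => (t : ℕ) < k ∧ t.castSucc ∉ S
  let J : Finset (Fin n) := Finset.univ.filter fun t => k ≤ (t : ℕ) + 1 ∧ t.succ ∈ S
  have hScard : S.card = k := by
    rw [Finset.card_image_of_injective _ hu, Finset.card_univ, Fintype.card_fin]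
  have hsplit := Finset.card_filter_add_card_filter_not (s := S) fun q : Fin (n + 1) => (q : ℕ) < k
  have hJ : (S.filter fun q : Fin (n + 1) => ¬ (q : ℕ) < k) = J.map (Fin.succEmb n) := by
    ext q
    simp only [Finset.mem_filter, Finset.mem_map, J, Finset.mem_univ, true_and, Fin.coe_succEmb]
    constructor
    · rintro ⟨hq, hqk⟩
      obtain ⟨t, rfl⟩ := Fin.exists_succ_eq.2 (show q ≠ 0 by rintro rfl; simp at hqk; omega)
      simp only [Fin.val_succ] at hqk
      exact ⟨t, ⟨by omega, hq⟩, rfl⟩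
    · rintro ⟨t, ⟨h1, h2⟩, rfl⟩
      simp only [Fin.val_succ]
      exact ⟨h2, by omega⟩
  have hI : (S.filter fun q : Fin (n + 1) => (q : ℕ) < k).card + I.card = k := by
    rw [← Finset.card_map (Fin.castSuccEmb (n := n)), ← Finset.card_union_of_disjoint]
    · have : (S.filter fun q : Fin (n + 1) => (q : ℕ) < k) ∪ I.map Fin.castSuccEmb
          = Finset.univ.map (Fin.castLEEmb (show k ≤ n + 1 by omega)) := by
        ext q
        simp only [Finset.mem_union, Finset.mem_filter, Finset.mem_map, I, Finset.mem_univ,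
          true_and, Fin.coe_castSuccEmb, Fin.castLEEmb_apply]
        constructor
        · rintro (⟨-, h⟩ | ⟨t, ⟨h1, -⟩, rfl⟩)
          · exact ⟨⟨q, h⟩, rfl⟩
          · exact ⟨⟨t, h1⟩, rfl⟩
        · rintro ⟨t, rfl⟩
          by_cases h : Fin.castLE (show k ≤ n + 1 by omega) t ∈ S
          · exact Or.inl ⟨h, t.2⟩
          · exact Or.inr ⟨Fin.castLE hkn t, ⟨t.2, h⟩, rfl⟩
      rw [this, Finset.card_map, Finset.card_univ, Fintype.card_fin]
    · rw [Finset.disjoint_left]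
      intro q hq hq'
      obtain ⟨t, ht, rfl⟩ := Finset.mem_map.1 hq'
      exact (Finset.mem_filter.1 ht).2.2 (Finset.mem_filter.1 hq).1
  rw [hJ, Finset.card_map, hScard] at hsplit
  have hIJ : J.card = I.card := by omega
  let i : Fin I.card → Fin n := I.orderEmbOfFin rfl
  let j : Fin I.card → Fin n := fun s => J.orderEmbOfFin hIJ s.rev
  have hi : Set.range i = I := Finset.range_orderEmbOfFin I rfl
  have hj : Set.range j = J := by
    rw [← Finset.range_orderEmbOfFin J hIJ]
    exact Fin.revPerm.surjective.range_comp (J.orderEmbOfFin hIJ)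
  have hiI : ∀ s, i s ∈ I := fun s => Finset.orderEmbOfFin_mem I rfl s
  have hjJ : ∀ s, j s ∈ J := fun s => Finset.orderEmbOfFin_mem J hIJ _
  have hmem : (i, j) ∈ nestedPairs n k I.card := by
    refine mem_nestedPairs.2 ⟨(I.orderEmbOfFin rfl).strictMono, ?_, ?_, ?_⟩
    · intro a b hab
      exact (J.orderEmbOfFin hIJ).strictMono (Fin.rev_lt_rev.2 hab)
    · exact fun s => (Finset.mem_filter.1 (hiI s)).2.1
    · exact fun s => (Finset.mem_filter.1 (hjJ s)).2.1
  refine ⟨I.card, (Finset.card_le_univ I).trans (by simp), (i, j), hmem, ?_⟩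
  ext q
  by_cases hq : (q : ℕ) < k
  · obtain ⟨t, rfl⟩ : ∃ t : Fin n, t.castSucc = q := ⟨⟨q, by omega⟩, rfl⟩
    rw [castSucc_mem_range_exchanged hkn hmem hq, hi, ← hS]
    simp only [Fin.val_castSucc] at hq
    simp [I, hq]
  · obtain ⟨t, rfl⟩ := Fin.exists_succ_eq.2 (show q ≠ 0 by rintro rfl; simp at hq; omega)
    simp only [Fin.val_succ] at hq
    rw [succ_mem_range_exchanged hkn hmem (by omega), hj, ← hS]
    simp [J, show k ≤ (t : ℕ) + 1 by omega]

lemma eq_of_range_exchanged_eq {m' : ℕ} {ij' : (Fin m' → Fin n) × (Fin m' → Fin n)}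
    (h : ij ∈ nestedPairs n k m) (h' : ij' ∈ nestedPairs n k m')
    (hr : Set.range (exchanged hkn ij) = Set.range (exchanged hkn ij')) :
    (⟨m, ij⟩ : Σ m, (Fin m → Fin n) × (Fin m → Fin n)) = ⟨m', ij'⟩ := by
  obtain ⟨h1, h2, h3, h4⟩ := mem_nestedPairs.1 h
  obtain ⟨h1', h2', h3', h4'⟩ := mem_nestedPairs.1 h'
  have hi : Set.range ij.1 = Set.range ij'.1 := by
    ext t
    by_cases ht : (t : ℕ) < k
    · rw [← not_iff_not, ← castSucc_mem_range_exchanged hkn h ht,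
        ← castSucc_mem_range_exchanged hkn h' ht, hr]
    · exact iff_of_false (by rintro ⟨s, rfl⟩; exact ht (h3 s)) (by rintro ⟨s, rfl⟩; exact ht (h3' s))
  have hj : Set.range ij.2 = Set.range ij'.2 := by
    ext t
    by_cases ht : k ≤ (t : ℕ) + 1
    · rw [← succ_mem_range_exchanged hkn h ht, ← succ_mem_range_exchanged hkn h' ht, hr]
    · exact iff_of_false (by rintro ⟨s, rfl⟩; exact ht (h4 s)) (by rintro ⟨s, rfl⟩; exact ht (h4' s))
  obtain rfl : m = m' := by
    have := congrArg Set.ncard hi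
    rwa [Set.ncard_range_of_injective h1.injective, Set.ncard_range_of_injective h1'.injective,
      Nat.card_fin, Nat.card_fin] at this
  have e1 : ij.1 = ij'.1 := (h1.range_inj h1').1 hi
  have e2 : OrderDual.toDual ∘ ij.2 = OrderDual.toDual ∘ ij'.2 :=
    (h2.dual_right.range_inj h2'.dual_right).1
    (by rw [Set.range_comp, Set.range_comp, hj])
  have e3 : ij.2 = ij'.2 := e2
  rw [Prod.ext e1 e3]

variable {A ι : Type*} [CommRing A] [IsDomain A] [Fintype ι] [DecidableEq ι]

/-- The Plücker relation for two matrices whose rows agree outside of the positions `Y 0, …, Y n`,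
indexed by the nested pairs of sequences. -/
theorem rowDet_mul_rowDet_eq_sum_nestedPairs (hk : 1 ≤ k) {L R : ι → ι → A} {Y : Fin (n + 1) → ι}
    (hY : Injective Y) (hLR : ∀ p ∉ Set.range Y, L p = R p) :
    rowDet (extend (fun t : Fin k => Y (Fin.castLE hkn t).succ)
        (fun t => R (Y (Fin.castLE hkn t).castSucc)) L) *
      rowDet (extend (fun t : Fin k => Y (Fin.castLE hkn t).castSucc)
        (fun t => L (Y (Fin.castLE hkn t).succ)) R) =
      ∑ m ∈ Finset.range (n + 1), ∑ ij ∈ nestedPairs n k m,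
        (-1) ^ m * rowDet (extend (fun s => Y (ij.2 s).succ) (fun s => L (Y (ij.1 s).succ)) R) *
          rowDet (extend (fun s => Y (ij.1 s).succ) (fun s => R (Y (ij.2 s).succ)) L) := by
  have hg : Injective fun t : Fin k => Y (Fin.castLE hkn t).castSucc := fun a b hab =>
    Fin.castLE_injective hkn (Fin.castSucc_injective _ (hY hab))
  have hf : Injective fun t : Fin k => Y (Fin.castLE hkn t).succ := fun a b hab =>
    Fin.castLE_injective hkn (Fin.succ_injective _ (hY hab))
  set T := extend (fun t : Fin k => Y (Fin.castLE hkn t).castSucc)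
        (fun t => L (Y (Fin.castLE hkn t).succ)) R with hT
  have hTR : ∀ p, (∀ t : Fin k, Y (Fin.castLE hkn t).castSucc ≠ p) → T p = R p := by
    intro p hp
    rw [hT, extend_apply' _ _ _ (by simpa using hp)]
  have hTL : ∀ t : Fin k, T (Y (Fin.castLE hkn t).castSucc) = L (Y (Fin.castLE hkn t).succ) :=
    fun t => hg.extend_apply _ _ t
  rw [← Finset.sum_sigma _ _ fun b : Σ m, (Fin m → Fin n) × (Fin m → Fin n) =>
    (-1) ^ b.1 * rowDet (extend (fun s => Y (b.2.2 s).succ) (fun s => L (Y (b.2.1 s).succ)) R) *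
      rowDet (extend (fun s => Y (b.2.1 s).succ) (fun s => R (Y (b.2.2 s).succ)) L)]
  refine (det_extend_mul_det (M := L) (T := T) (Y := Set.range Y) ?_ hf (fun t => ⟨_, rfl⟩) _
    ((Finset.range (n + 1)).sigma fun m => nestedPairs n k m)
    (fun b => Y ∘ exchanged hkn b.2) ?_ (fun _ _ _ => ⟨_, rfl⟩) ?_ ?_).trans ?_
  · rintro p hp
    rw [hLR p hp, hTR p fun t ht => hp ⟨_, ht⟩]
  · rintro ⟨m, ij⟩ hb
    exact hY.comp (exchanged_injective hkn (Finset.mem_sigma.1 hb).2)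
  · intro u hu huY
    choose v hv using huY
    obtain rfl : Y ∘ v = u := funext hv
    obtain ⟨m, hm, ij, hij, h⟩ := exists_range_exchanged_eq hkn hk v (Injective.of_comp hu)
    refine ⟨⟨m, ij⟩, Finset.mem_sigma.2 ⟨Finset.mem_range.2 (by simpa using by omega), hij⟩, ?_⟩
    rw [Set.range_comp, Set.range_comp, h]
  · rintro ⟨m, ij⟩ hb ⟨m', ij'⟩ hb' hr
    rw [Set.range_comp, Set.range_comp] at hr
    exact eq_of_range_exchanged_eq hkn (Finset.mem_sigma.1 hb).2 (Finset.mem_sigma.1 hb').2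
      (hY.image_injective hr)
  refine Finset.sum_congr rfl ?_
  rintro ⟨m, ij⟩ hb
  have hij : ij ∈ nestedPairs n k m := (Finset.mem_sigma.1 hb).2
  obtain ⟨h1, h2, h3, h4⟩ := mem_nestedPairs.1 hij
  have hne : ∀ (t : Fin k) (s : Fin m), (Fin.castLE hkn t).castSucc ≠ (ij.2 s).succ := by
    intro t s h
    have := h4 s
    rw [Fin.ext_iff] at h
    simp at h
    omega
  have hi : Injective fun s => Y (ij.1 s).succ := fun a b hab =>
    h1.injective (Fin.succ_injective _ (hY hab))
  have hi' : Injective fun s => Y (ij.1 s).castSucc := fun a b hab =>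
    h1.injective (Fin.castSucc_injective _ (hY hab))
  have hj : Injective fun s => Y (ij.2 s).succ := fun a b hab =>
    h2.injective (Fin.succ_injective _ (hY hab))
  have hw : Injective (Y ∘ exchanged hkn ij) := hY.comp (exchanged_injective hkn hij)
  have hTw : ∀ (t : Fin k) (s : Fin m), ij.1 s = Fin.castLE hkn t →
      T ((Y ∘ exchanged hkn ij) t) = R (Y (ij.2 s).succ) := by
    intro t s hs
    rw [comp_apply, exchanged_of_eq hkn hij hs, hTR]
    exact fun t' ht' => hne t' s (hY ht')
  have e1 : extend (fun t : Fin k => Y (Fin.castLE hkn t).succ) (T ∘ (Y ∘ exchanged hkn ij)) L =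
      extend (fun s => Y (ij.1 s).succ) (fun s => R (Y (ij.2 s).succ)) L := by
    funext p
    by_cases hp : ∃ t : Fin k, Y (Fin.castLE hkn t).succ = p
    · obtain ⟨t, rfl⟩ := hp
      rw [hf.extend_apply, comp_apply]
      by_cases ht : ∃ s, ij.1 s = Fin.castLE hkn t
      · obtain ⟨s, hs⟩ := ht
        rw [hTw t s hs, ← hs, hi.extend_apply]
      · rw [extend_apply', comp_apply, exchanged_of_notMem hkn ht, hTL]
        rintro ⟨s, hs⟩
        exact ht ⟨s, Fin.succ_injective _ (hY hs)⟩
    · rw [extend_apply' _ _ _ hp, extend_apply']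
      rintro ⟨s, rfl⟩
      exact hp ⟨⟨ij.1 s, h3 s⟩, rfl⟩
  set N := extend (fun s => Y (ij.2 s).succ) (fun s => L (Y (ij.1 s).succ)) R with hN
  have hNR : ∀ p, (∀ s, Y (ij.2 s).succ ≠ p) → N p = R p := by
    intro p hp
    rw [hN, extend_apply' _ _ _ (by simpa using hp)]
  have hNL : ∀ s, N (Y (ij.2 s).succ) = L (Y (ij.1 s).succ) := fun s => hj.extend_apply _ _ s
  let f : Fin m ⊕ Fin m → ι :=
    Sum.elim (fun s => Y (ij.1 s).castSucc) (fun s => Y (ij.2 s).succ)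
  have hff : Injective f := hi'.sumElim hj fun a b hab => hne ⟨ij.1 a, h3 a⟩ b (hY hab)
  have e2 : extend (Y ∘ exchanged hkn ij) (fun t => R (Y (Fin.castLE hkn t).castSucc)) T =
      extend f (N ∘ f ∘ Sum.swap) N := by
    have hel : ∀ s, N (Y (ij.1 s).castSucc) = R (Y (ij.1 s).castSucc) := fun s =>
      hNR _ fun s' hs' => hne ⟨ij.1 s, h3 s⟩ s' (hY hs'.symm)
    funext p
    by_cases hp : ∃ a, f a = p
    · obtain ⟨a | a, rfl⟩ := hp
      · rw [hff.extend_apply, extend_apply']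
        · exact (hTL ⟨ij.1 a, h3 a⟩).trans (hNL a).symm
        · rintro ⟨t, ht⟩
          exact (castSucc_mem_range_exchanged hkn hij (h3 a)).1 ⟨t, hY ht⟩ ⟨a, rfl⟩
      · have : f (Sum.inr a) = (Y ∘ exchanged hkn ij) ⟨ij.1 a, h3 a⟩ := by
          rw [comp_apply, exchanged_of_eq hkn hij (s := a) rfl]
          rfl
        rw [hff.extend_apply, this, hw.extend_apply]
        exact (hel a).symm
    · rw [extend_apply' _ _ _ hp, hNR p fun s hs => hp ⟨Sum.inr s, hs⟩]
      by_cases hpw : ∃ t, (Y ∘ exchanged hkn ij) t = p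
      · obtain ⟨t, rfl⟩ := hpw
        have ht : ¬ ∃ s, ij.1 s = Fin.castLE hkn t := by
          rintro ⟨s, hs⟩
          exact hp ⟨Sum.inr s, by rw [comp_apply, exchanged_of_eq hkn hij hs]; rfl⟩
        rw [hw.extend_apply, comp_apply, exchanged_of_notMem hkn ht]
      · rw [extend_apply' _ _ _ hpw, hTR]
        rintro t rfl
        refine hpw ⟨t, ?_⟩
        rw [comp_apply, exchanged_of_notMem]
        rintro ⟨s, hs⟩
        exact hp ⟨Sum.inl s, by simp [f, hs]⟩
  rw [e1, e2, det_extend_exchange N f hff, Fintype.card_fin]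
  ring

end Nested

section Corner

open Function

variable {n : ℕ}

/-- The part at the (`0`-indexed) position `p` of the partition with the given corner data. -/
noncomputable def partAt (d : CornerData n) (p : ℤ) : ℤ :=
  if h : (Finset.univ.filter fun q : Fin n => d.2 q.succ ≤ p).card < n then d.1 ⟨_, h⟩ else 0

/-- The `c`-th part size (`0`-indexed), which is `0` for `c ≥ n`. -/
def partSize (d : CornerData n) (c : ℕ) : ℤ := if h : c < n then d.1 ⟨c, h⟩ else 0

lemma partAt_eq_partSize {d : CornerData n} {p : ℤ} {c : ℕ} (hc : c ≤ n)
    (h : ∀ q : Fin n, d.2 q.succ ≤ p ↔ (q : ℕ) < c) : partAt d p = partSize d c := by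
  have : (Finset.univ.filter fun q : Fin n => d.2 q.succ ≤ p).card = c := by
    simp only [h]
    rw [Fin.card_filter_val_lt, min_eq_right hc]
  simp only [partAt, partSize, this]

lemma exists_le_iff_lt {d : CornerData n} (hd : Monotone d.2) (p : ℤ) :
    ∃ c ≤ n, ∀ q : Fin n, d.2 q.succ ≤ p ↔ (q : ℕ) < c := by
  have hex : ∃ c, ∀ q : Fin n, c ≤ (q : ℕ) → p < d.2 q.succ := ⟨n, fun q hq => by omega⟩
  refine ⟨Nat.find hex, Nat.find_min' hex fun q hq => by omega, fun q => ⟨fun hq => ?_, fun hq => ?_⟩⟩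
  · by_contra! hc
    exact (Nat.find_spec hex q hc).not_ge hq
  · by_contra! hc
    refine Nat.find_min hex hq fun q' hq' => hc.trans_le (hd ?_)
    exact Fin.succ_le_succ_iff.2 hq'

lemma partAt_eq_zero {d : CornerData n} (hd : Monotone d.2) {p : ℤ} (hp : d.2 (Fin.last n) ≤ p) :
    partAt d p = 0 := by
  rw [partAt_eq_partSize le_rfl fun q => iff_of_true ((hd (Fin.le_last _)).trans hp) q.2]
  simp [partSize]

variable (N r : ℕ)

/-- The row `(h_a, h_{a+1}, …, h_{a+r})`. -/
noncomputable def hRow (a : ℤ) : Fin (r + 1) → MvPolynomial (Fin N) ℤ :=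
  fun j => hciz N (a + (j : ℕ))

/-- The rows of the Jacobi–Trudi matrix of size `r + 1`. -/
noncomputable def lowerRows (d : CornerData n) (p : Fin (r + 1)) :
    Fin (r + 1) → MvPolynomial (Fin N) ℤ :=
  hRow N r (partAt d (p : ℕ) - (p : ℕ))

/-- The rows of the Jacobi–Trudi matrix of size `r`, bordered by a first unit row. -/
noncomputable def upperRows (d : CornerData n) (p : Fin (r + 1)) :
    Fin (r + 1) → MvPolynomial (Fin N) ℤ :=
  if p = 0 then Pi.single 0 1 else hRow N r (partAt d ((p : ℕ) - 1) - (p : ℕ))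

lemma hciz_zero : hciz N 0 = 1 := by
  simp [hciz, MvPolynomial.hsymm_zero]

lemma hciz_of_neg {a : ℤ} (ha : a < 0) : hciz N a = 0 := by
  simp [hciz, ha]

lemma schurOf_eq_det {d : CornerData n} (hd : Monotone d.2) {M : ℕ}
    (hM : (d.2 (Fin.last n)).toNat ≤ M) :
    schurOf N d =
      (Matrix.of fun p j : Fin M => hciz N (partAt d (p : ℕ) - (p : ℕ) + (j : ℕ))).det := by
  induction M, hM using Nat.le_induction with
  | base => rfl
  | succ M hM ih =>
    rw [ih, Matrix.det_succ_row _ (Fin.last M), Fin.sum_univ_castSucc, Finset.sum_eq_zero, zero_add]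
    · rw [Matrix.of_apply, partAt_eq_zero hd (by simp; omega)]
      simp only [Fin.succAbove_last, Fin.val_last, zero_sub, neg_add_cancel, hciz_zero]
      rw [Even.neg_one_pow ⟨M, rfl⟩, one_mul, one_mul]
      rfl
    · intro j _
      rw [Matrix.of_apply, partAt_eq_zero hd (by simp; omega), hciz_of_neg, mul_zero, zero_mul]
      have := j.2
      simp only [Fin.val_last, Fin.val_castSucc]
      omega

lemma schurOf_eq_rowDet_lowerRows {d : CornerData n} (hd : Monotone d.2)
    (hr : d.2 (Fin.last n) ≤ r + 1) : schurOf N d = rowDet (lowerRows N r d) :=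
  schurOf_eq_det N hd (by omega)

lemma schurOf_eq_rowDet_upperRows {d : CornerData n} (hd : Monotone d.2)
    (hr : d.2 (Fin.last n) ≤ r) : schurOf N d = rowDet (upperRows N r d) := by
  rw [schurOf_eq_det N hd (M := r) (by omega), rowDet, Matrix.det_succ_row_zero,
    Finset.sum_eq_single_of_mem 0 (Finset.mem_univ _)]
  · have : Matrix.of (upperRows N r d) 0 0 = 1 := by simp [upperRows]
    rw [this]
    simp only [Fin.val_zero, pow_zero, one_mul]
    congr 1
    ext p j
    simp only [Matrix.of_apply, Matrix.submatrix_apply, upperRows, Fin.succ_ne_zero, if_false,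
      hRow, Fin.succAbove_zero, Fin.val_succ]
    congr 2
    push_cast
    ring_nf
  · intro j _ hj
    have : Matrix.of (upperRows N r d) 0 j = 0 := by simp [upperRows, hj]
    rw [this, mul_zero, zero_mul]

lemma partAt_eq_partAt_add {d d' : CornerData n} (hd : Monotone d.2) {p p' e : ℤ}
    (h2 : ∀ q : Fin n, d'.2 q.succ ≤ p' ↔ d.2 q.succ ≤ p)
    (h1 : ∀ c : Fin n, (∀ q : Fin n, d.2 q.succ ≤ p ↔ q < c) → d'.1 c = d.1 c + e)
    (h0 : (∀ q : Fin n, d.2 q.succ ≤ p) → e = 0) : partAt d' p' = partAt d p + e := by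
  obtain ⟨c, hc, h⟩ := exists_le_iff_lt hd p
  rw [partAt_eq_partSize hc h, partAt_eq_partSize hc fun q => (h2 q).trans (h q), partSize,
    partSize]
  split_ifs with hcn
  · exact h1 ⟨c, hcn⟩ h
  · rw [h0 fun q => (h q).2 (by omega), add_zero]

lemma partAt_eq_partAt {d d' : CornerData n} (hd : Monotone d.2) {p p' : ℤ}
    (h2 : ∀ q : Fin n, d'.2 q.succ ≤ p' ↔ d.2 q.succ ≤ p)
    (h1 : ∀ c : Fin n, (∀ q : Fin n, d.2 q.succ ≤ p ↔ q < c) → d'.1 c = d.1 c) :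
    partAt d' p' = partAt d p := by
  rw [partAt_eq_partAt_add hd (e := 0) h2 (by simpa using h1) fun _ => rfl, add_zero]

lemma piOp_fst (d : CornerData n) (i j p : Fin n) :
    (piOp (i + 1) (j + 1) d).1 p = if i < p ∧ p ≤ j then d.1 p + 1 else d.1 p := by
  simp only [piOp, Fin.le_def, Fin.lt_def, Nat.succ_le_iff, Nat.lt_succ_iff]

lemma piOp_snd (d : CornerData n) (i j : Fin n) (q : Fin (n + 1)) :
    (piOp (i + 1) (j + 1) d).2 q = if i.succ ≤ q ∧ q ≤ j.succ then d.2 q + 1 else d.2 q := by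
  simp only [piOp, Fin.le_def, Fin.val_succ]

lemma piOp_snd_succ (d : CornerData n) (i j q : Fin n) :
    (piOp (i + 1) (j + 1) d).2 q.succ = if i ≤ q ∧ q ≤ j then d.2 q.succ + 1 else d.2 q.succ := by
  simp only [piOp_snd, Fin.succ_le_succ_iff]

lemma muOp_fst (d : CornerData n) (i j p : Fin n) :
    (muOp (i + 1) (j + 1) d).1 p = if i < p ∧ p ≤ j then d.1 p - 1 else d.1 p := by
  simp only [muOp, Fin.le_def, Fin.lt_def, Nat.succ_le_iff, Nat.lt_succ_iff]

lemma muOp_snd (d : CornerData n) (i j : Fin n) (q : Fin (n + 1)) :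
    (muOp (i + 1) (j + 1) d).2 q = if i.succ ≤ q ∧ q ≤ j.succ then d.2 q - 1 else d.2 q := by
  simp only [muOp, Fin.le_def, Fin.val_succ]

lemma muOp_snd_succ (d : CornerData n) (i j q : Fin n) :
    (muOp (i + 1) (j + 1) d).2 q.succ = if i ≤ q ∧ q ≤ j then d.2 q.succ - 1 else d.2 q.succ := by
  simp only [muOp_snd, Fin.succ_le_succ_iff]

lemma monotone_piOp {d : CornerData n} (hd : Monotone d.2) {i j : Fin n}
    (hj : ∀ q, j.succ < q → d.2 j.succ < d.2 q) : Monotone (piOp (i + 1) (j + 1) d).2 := by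
  intro p q hpq
  rw [piOp_snd, piOp_snd]
  have h1 := hd hpq
  split_ifs with hp hq hq
  · omega
  · have := hj q (by by_contra! h; exact hq ⟨hp.1.trans hpq, h⟩)
    have := hd hp.2
    omega
  · omega
  · omega

lemma monotone_muOp {d : CornerData n} (hd : Monotone d.2) {i j : Fin n}
    (hi : ∀ q, q < i.succ → d.2 q < d.2 i.succ) : Monotone (muOp (i + 1) (j + 1) d).2 := by
  intro p q hpq
  rw [muOp_snd, muOp_snd]
  have h1 := hd hpq
  split_ifs with hp hq hq
  · omega
  · omega
  · have := hi p (by by_contra! h; exact hp ⟨h, hpq.trans hq.2⟩)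
    have := hd hq.1
    omega
  · omega

lemma lowerRows_piOp_comp_cycleIcc {d : CornerData n} (hd : Monotone d.2) {i j : Fin n}
    (hij : i ≤ j) (hj : ∀ q, j.succ < q → d.2 j.succ < d.2 q) {a b : Fin (r + 1)}
    (ha : ((a : ℕ) : ℤ) = d.2 i.succ) (hb : ((b : ℕ) : ℤ) = d.2 j.succ) :
    lowerRows N r (piOp (i + 1) (j + 1) d) ∘ Fin.cycleIcc a b =
      update (lowerRows N r d) b (hRow N r (d.1 i - d.2 i.succ)) := by
  have hab : a ≤ b := by
    have := hd (Fin.succ_le_succ_iff.2 hij)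
    rw [Fin.le_def]; omega
  have hsucc : ∀ {p q : Fin n}, p ≤ q → d.2 p.succ ≤ d.2 q.succ := fun h =>
    hd (Fin.succ_le_succ_iff.2 h)
  have hjs : ∀ q, j < q → d.2 j.succ < d.2 q.succ := fun q hq => hj _ (Fin.succ_lt_succ_iff.2 hq)
  funext q
  rw [comp_apply]
  rcases lt_trichotomy q b with hqb | rfl | hqb
  · rw [update_of_ne hqb.ne]
    rcases lt_or_ge q a with hqa | hqa
    · rw [Fin.cycleIcc_of_lt hqa, lowerRows, lowerRows, partAt_eq_partAt hd]
      · intro p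
        rw [piOp_snd_succ]
        split_ifs with h
        · have := hsucc h.1
          rw [Fin.lt_def] at hqa
          omega
        · rfl
      · intro c hc
        have := (hc i).not
        rw [piOp_fst, if_neg]
        rw [Fin.lt_def] at hqa
        have := this.1 (by omega)
        omega
    · rw [Fin.cycleIcc_of_ge_of_lt hqa hqb, lowerRows, lowerRows]
      have hv : ((q + 1 : Fin (r + 1)) : ℕ) = q + 1 := Fin.val_add_one_of_lt' (by omega)
      rw [partAt_eq_partAt_add hd (p := (q : ℕ)) (e := 1)]
      · rw [hv]
        congr 1
        push_cast
        ring
      · intro p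
        rw [hv, piOp_snd_succ]
        rw [Fin.lt_def] at hqb
        rw [Fin.le_def] at hqa
        split_ifs with h
        · push_cast
          omega
        · rcases lt_or_ge p i with hp | hp
          · have := hsucc hp.le
            push_cast
            omega
          · have := hjs p (by omega)
            push_cast
            omega
      · intro c hc
        rw [Fin.lt_def] at hqb
        rw [Fin.le_def] at hqa
        have h1 := (hc i).1 (by omega)
        have h2 := (hc j).not.1 (by omega)
        rw [piOp_fst, if_pos ⟨h1, not_lt.1 h2⟩]
      · intro h
        have := h j
        rw [Fin.lt_def] at hqb
        omega
  · rw [Fin.cycleIcc_of_last hab, update_self, lowerRows, ha, partAt_eq_partSize (c := i) i.2.le]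
    · rw [partSize, dif_pos i.2, piOp_fst, if_neg (by simp)]
    · intro p
      rw [piOp_snd_succ, ← Fin.lt_def]
      split_ifs with h
      · have := hsucc h.1
        omega
      · rcases lt_or_ge p i with hp | hp
        · simp [hp, hsucc hp.le]
        · have := hjs p (by omega)
          have := hsucc hij
          omega
  · rw [update_of_ne hqb.ne', Fin.cycleIcc_of_gt hqb, lowerRows, lowerRows, partAt_eq_partAt hd]
    · intro p
      rw [piOp_snd_succ]
      split_ifs with h
      · have := hsucc h.2
        rw [Fin.lt_def] at hqb
        omega
      · rfl
    · intro c hc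
      rw [Fin.lt_def] at hqb
      have := (hc j).1 (by omega)
      rw [piOp_fst, if_neg]
      omega

lemma upperRows_muOp {d : CornerData n} (hd : Monotone d.2) {i j : Fin n}
    (hij : i ≤ j) (hi : ∀ q, q < i.succ → d.2 q < d.2 i.succ) {a b : Fin (r + 1)} (ha0 : a ≠ 0)
    (ha : ((a : ℕ) : ℤ) = d.2 i.succ) (hb : ((b : ℕ) : ℤ) = d.2 j.succ)
    (hj : ∀ q, j.succ < q → d.2 j.succ < d.2 q) :
    upperRows N r (muOp (i + 1) (j + 1) d) =
      update (upperRows N r d) a (hRow N r (partSize d (j + 1) - d.2 j.succ)) ∘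
        Fin.cycleIcc a b := by
  have hab : a ≤ b := by
    have := hd (Fin.succ_le_succ_iff.2 hij)
    rw [Fin.le_def]; omega
  have hsucc : ∀ {p q : Fin n}, p ≤ q → d.2 p.succ ≤ d.2 q.succ := fun h =>
    hd (Fin.succ_le_succ_iff.2 h)
  have hjs : ∀ q, j < q → d.2 j.succ < d.2 q.succ := fun q hq => hj _ (Fin.succ_lt_succ_iff.2 hq)
  have his : ∀ q, q < i → d.2 q.succ < d.2 i.succ := fun q hq => hi _ (Fin.succ_lt_succ_iff.2 hq)
  have ha0' : 0 < (a : ℕ) := Fin.pos_iff_ne_zero.2 ha0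
  funext q
  rw [comp_apply]
  rcases lt_trichotomy q b with hqb | rfl | hqb
  · rcases lt_or_ge q a with hqa | hqa
    · rw [Fin.cycleIcc_of_lt hqa, update_of_ne hqa.ne, upperRows, upperRows]
      congr 3
      rw [Fin.lt_def] at hqa
      refine partAt_eq_partAt hd (fun p => ?_) fun c hc => ?_
      · rw [muOp_snd_succ]
        split_ifs with h
        · have := hsucc h.1
          omega
        · rfl
      · have := (hc i).not.1 (by omega)
        rw [muOp_fst, if_neg]
        omega
    · rw [Fin.cycleIcc_of_ge_of_lt hqa hqb]
      have hv : ((q + 1 : Fin (r + 1)) : ℕ) = q + 1 := Fin.val_add_one_of_lt' (by omega)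
      rw [Fin.lt_def] at hqb
      rw [Fin.le_def] at hqa
      rw [update_of_ne (by rw [ne_eq, Fin.ext_iff]; omega), upperRows, upperRows, if_neg, if_neg,
        partAt_eq_partAt_add hd (p := (q : ℕ)) (e := -1)]
      · rw [hv]
        push_cast
        ring_nf
      · intro p
        rw [muOp_snd_succ]
        split_ifs with h
        · omega
        · rcases lt_or_ge p i with hp | hp
          · have := his p hp
            omega
          · have := hjs p (by omega)
            omega
      · intro c hc
        have h1 := (hc i).1 (by omega)
        have h2 := (hc j).not.1 (by omega)
        rw [muOp_fst, if_pos ⟨h1, not_lt.1 h2⟩, sub_eq_add_neg]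
      · intro h
        have := h j
        omega
      · rw [Fin.ext_iff, hv]
        simp
      · rw [Fin.ext_iff, Fin.val_zero]
        omega
  · rw [Fin.cycleIcc_of_last hab, update_self, upperRows, if_neg, hb,
      partAt_eq_partSize (c := j + 1) j.2]
    · rw [partSize, partSize]
      split_ifs with h
      · rw [muOp_fst, if_neg]
        simp [Fin.le_def]
      · rfl
    · intro p
      rw [muOp_snd_succ, Nat.lt_succ_iff, ← Fin.le_def]
      split_ifs with h
      · have := hsucc h.2
        simp [h.2]
        omega
      · rcases lt_or_ge p i with hp | hp
        · have := his p hp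
          have := hsucc hij
          exact iff_of_true (by omega) (by omega)
        · have := hjs p (by omega)
          exact iff_of_false (by omega) (by omega)
    · rw [Fin.ext_iff, Fin.val_zero]
      rw [Fin.le_def] at hab
      omega
  · rw [Fin.cycleIcc_of_gt hqb, update_of_ne (hab.trans_lt hqb).ne', upperRows, upperRows]
    congr 3
    rw [Fin.lt_def] at hqb
    refine partAt_eq_partAt hd (fun p => ?_) fun c hc => ?_
    · rw [muOp_snd_succ]
      split_ifs with h
      · have := hsucc h.2
        omega
      · rfl
    · have := (hc j).1 (by omega)
      rw [muOp_fst, if_neg]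
      omega

lemma opComp_succ {m : ℕ} (g : Fin (m + 1) → CornerData n → CornerData n) (d : CornerData n) :
    opComp (m + 1) g d = g 0 (opComp m (fun t => g t.succ) d) := by
  simp [opComp, List.ofFn_succ]

/-- The operation `π` for a pair of (`0`-indexed) sequences. -/
def piComp {m : ℕ} (i j : Fin m → Fin n) : CornerData n → CornerData n :=
  opComp m fun t => piOp ((i t : ℕ) + 1) ((j t : ℕ) + 1)

/-- The operation `μ` for a pair of (`0`-indexed) sequences. -/
def muComp {m : ℕ} (i j : Fin m → Fin n) : CornerData n → CornerData n :=
  opComp m fun t => muOp ((i t : ℕ) + 1) ((j t : ℕ) + 1)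

lemma piComp_succ {m : ℕ} (i j : Fin (m + 1) → Fin n) (d : CornerData n) :
    piComp i j d = piOp ((i 0 : ℕ) + 1) ((j 0 : ℕ) + 1)
      (piComp (fun s => i s.succ) (fun s => j s.succ) d) := opComp_succ _ d

lemma muComp_succ {m : ℕ} (i j : Fin (m + 1) → Fin n) (d : CornerData n) :
    muComp i j d = muOp ((i 0 : ℕ) + 1) ((j 0 : ℕ) + 1)
      (muComp (fun s => i s.succ) (fun s => j s.succ) d) := opComp_succ _ d

lemma comp_fst_eq {m : ℕ} (i j : Fin m → Fin n) (d : CornerData n) {p : Fin n}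
    (hp : ∀ s, p ≤ i s ∨ j s < p) : (piComp i j d).1 p = d.1 p ∧ (muComp i j d).1 p = d.1 p := by
  induction m with
  | zero => exact ⟨rfl, rfl⟩
  | succ m ih =>
    have h0 := hp 0
    rw [piComp_succ, muComp_succ, piOp_fst, muOp_fst, if_neg (by omega), if_neg (by omega)]
    exact ih _ _ fun s => hp s.succ

lemma comp_snd_eq {m : ℕ} (i j : Fin m → Fin n) (d : CornerData n) {q : Fin (n + 1)}
    (hq : ∀ s, q < (i s).succ ∨ (j s).succ < q) :
    (piComp i j d).2 q = d.2 q ∧ (muComp i j d).2 q = d.2 q := by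
  induction m with
  | zero => exact ⟨rfl, rfl⟩
  | succ m ih =>
    have h0 : ¬ ((i 0).succ ≤ q ∧ q ≤ (j 0).succ) := by
      have := hq 0
      rw [not_and_or, not_le, not_le]
      exact this
    rw [piComp_succ, muComp_succ, piOp_snd, muOp_snd, if_neg h0, if_neg h0]
    exact ih _ _ fun s => hq s.succ

lemma comp_snd_lt_of_lt {m : ℕ} {i j : Fin (m + 1) → Fin n} (hj : StrictAnti j) {d : CornerData n}
    (hd : StrictMono d.2) (q : Fin (n + 1)) (hq : (j 0).succ < q) :
    (piComp (fun s => i s.succ) (fun s => j s.succ) d).2 (j 0).succ <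
        (piComp (fun s => i s.succ) (fun s => j s.succ) d).2 q ∧
      (muComp (fun s => i s.succ) (fun s => j s.succ) d).2 (j 0).succ <
        (muComp (fun s => i s.succ) (fun s => j s.succ) d).2 q := by
  have h : ∀ s : Fin m, (j s.succ).succ < (j 0).succ := fun s =>
    Fin.succ_lt_succ_iff.2 (hj s.succ_pos)
  have h1 := comp_snd_eq (fun s : Fin m => i s.succ) (fun s => j s.succ) d fun s => Or.inr (h s)
  have h2 := comp_snd_eq (fun s : Fin m => i s.succ) (fun s => j s.succ) d
    fun s => Or.inr ((h s).trans hq)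
  rw [h1.1, h1.2, h2.1, h2.2]
  exact ⟨hd hq, hd hq⟩

lemma comp_snd_lt_of_gt {m : ℕ} {i j : Fin (m + 1) → Fin n} (hi : StrictMono i) {d : CornerData n}
    (hd : StrictMono d.2) (q : Fin (n + 1)) (hq : q < (i 0).succ) :
    (piComp (fun s => i s.succ) (fun s => j s.succ) d).2 q <
        (piComp (fun s => i s.succ) (fun s => j s.succ) d).2 (i 0).succ ∧
      (muComp (fun s => i s.succ) (fun s => j s.succ) d).2 q <
        (muComp (fun s => i s.succ) (fun s => j s.succ) d).2 (i 0).succ := by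
  have h : ∀ s : Fin m, (i 0).succ < (i s.succ).succ := fun s =>
    Fin.succ_lt_succ_iff.2 (hi s.succ_pos)
  have h1 := comp_snd_eq (fun s : Fin m => i s.succ) (fun s => j s.succ) d fun s => Or.inl (h s)
  have h2 := comp_snd_eq (fun s : Fin m => i s.succ) (fun s => j s.succ) d
    fun s => Or.inl (hq.trans (h s))
  rw [h1.1, h1.2, h2.1, h2.2]
  exact ⟨hd hq, hd hq⟩

lemma monotone_comp {m : ℕ} {i j : Fin m → Fin n} (hi : StrictMono i) (hj : StrictAnti j)
    {d : CornerData n} (hd : StrictMono d.2) :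
    Monotone (piComp i j d).2 ∧ Monotone (muComp i j d).2 := by
  induction m with
  | zero => exact ⟨hd.monotone, hd.monotone⟩
  | succ m ih =>
    have := ih (hi.comp (Fin.strictMono_succ)) (hj.comp_strictMono Fin.strictMono_succ)
    rw [piComp_succ, muComp_succ]
    exact ⟨monotone_piOp this.1 fun q hq => (comp_snd_lt_of_lt hj hd q hq).1,
      monotone_muOp this.2 fun q hq => (comp_snd_lt_of_gt hi hd q hq).2⟩

lemma piComp_snd_last_le {m : ℕ} {i j : Fin m → Fin n} (hj : StrictAnti j) (d : CornerData n) :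
    (piComp i j d).2 (Fin.last n) ≤ d.2 (Fin.last n) + 1 := by
  cases m with
  | zero => exact (lt_add_one _).le
  | succ m =>
    have := (comp_snd_eq (fun s : Fin m => i s.succ) (fun s => j s.succ) d (q := Fin.last n)
      fun s => Or.inr ((Fin.succ_lt_succ_iff.2 (hj s.succ_pos)).trans_le (Fin.le_last _))).1
    rw [piComp_succ, piOp_snd, this]
    split_ifs <;> omega

lemma muComp_snd_le {m : ℕ} (i j : Fin m → Fin n) (d : CornerData n) (q : Fin (n + 1)) :
    (muComp i j d).2 q ≤ d.2 q := by
  induction m with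
  | zero => exact le_rfl
  | succ m ih =>
    have := ih (fun s => i s.succ) fun s => j s.succ
    rw [muComp_succ, muOp_snd]
    split_ifs <;> omega

lemma extend_fin_succ {ι A : Type*} [DecidableEq ι] {m : ℕ} {f : Fin (m + 1) → ι}
    (hf : Injective f) (g : Fin (m + 1) → A) (e : ι → A) :
    extend f g e =
      update (extend (fun s : Fin m => f s.succ) (fun s => g s.succ) e) (f 0) (g 0) := by
  have hf' : Injective fun s : Fin m => f s.succ := hf.comp (Fin.succ_injective m)
  funext p
  by_cases hp : ∃ s, f s = p
  · obtain ⟨s, rfl⟩ := hp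
    rw [hf.extend_apply]
    cases s using Fin.cases with
    | zero => rw [update_self]
    | succ s => rw [update_of_ne (hf.ne s.succ_ne_zero), hf'.extend_apply]
  · rw [extend_apply' _ _ _ hp, update_of_ne fun h => hp ⟨0, h.symm⟩, extend_apply']
    rintro ⟨s, hs⟩
    exact hp ⟨s.succ, hs⟩

section Rows

variable {N r} {d : CornerData n} {Y : Fin (n + 1) → Fin (r + 1)}

lemma strictMono_of_val_eq (hd : StrictMono d.2) (hY : ∀ q, ((Y q : ℕ) : ℤ) = d.2 q) :
    StrictMono Y := fun a b hab => by
  have := hd hab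
  rw [← hY, ← hY] at this
  exact_mod_cast this

lemma upperRows_apply_succ (hd : StrictMono d.2) (hY : ∀ q, ((Y q : ℕ) : ℤ) = d.2 q)
    (hd0 : 0 ≤ d.2 0) (t : Fin n) :
    upperRows N r d (Y t.succ) = hRow N r (d.1 t - d.2 t.succ) := by
  have h0 := hd t.succ_pos
  have hYt := hY t.succ
  rw [upperRows, if_neg (by rw [Fin.ext_iff, Fin.val_zero]; omega), hYt,
    partAt_eq_partSize (c := t) t.2.le, partSize, dif_pos t.2]
  intro q
  rw [← Fin.lt_def, ← Fin.succ_lt_succ_iff, ← hd.lt_iff_lt]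
  omega

lemma lowerRows_apply (hd : StrictMono d.2) (hY : ∀ q, ((Y q : ℕ) : ℤ) = d.2 q)
    (t : Fin (n + 1)) :
    lowerRows N r d (Y t) = hRow N r (partSize d t - d.2 t) := by
  rw [lowerRows, hY, partAt_eq_partSize (c := t) t.is_le]
  intro q
  rw [hd.le_iff_le, Fin.le_def, Fin.val_succ]
  omega

lemma exists_perm_rows_comp (hd : StrictMono d.2) (hY : ∀ q, ((Y q : ℕ) : ℤ) = d.2 q)
    (hd0 : 0 ≤ d.2 0) {m : ℕ} {i j : Fin m → Fin n} (hi : StrictMono i)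
    (hj : StrictAnti j) (hij : ∀ s t, i s ≤ j t) :
    ∃ σ τ : Equiv.Perm (Fin (r + 1)), Equiv.Perm.sign σ = Equiv.Perm.sign τ ∧
      (∀ p, (∀ s, p < Y (i s).succ ∨ Y (j s).succ < p) → σ p = p ∧ τ p = p) ∧
      lowerRows N r (piComp i j d) = extend (fun s => Y (j s).succ)
        (fun s => upperRows N r d (Y (i s).succ)) (lowerRows N r d) ∘ σ ∧
      upperRows N r (muComp i j d) = extend (fun s => Y (i s).succ)
        (fun s => lowerRows N r d (Y (j s).succ)) (upperRows N r d) ∘ τ := by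
  have hYm := strictMono_of_val_eq hd hY
  induction m with
  | zero =>
    refine ⟨1, 1, rfl, fun _ _ => ⟨rfl, rfl⟩, ?_, ?_⟩ <;>
    · funext p
      rw [comp_apply, extend_apply' _ _ _ (by simp)]
      rfl
  | succ m ih =>
    have hi' : StrictMono fun s : Fin m => i s.succ := hi.comp Fin.strictMono_succ
    have hj' : StrictAnti fun s : Fin m => j s.succ := hj.comp_strictMono Fin.strictMono_succ
    obtain ⟨σ, τ, hs, hfix, hσ, hτ⟩ := ih hi' hj' fun s t => hij _ _
    have hYi : Injective fun s => Y (i s).succ :=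
      hYm.injective.comp ((Fin.succ_injective n).comp hi.injective)
    have hYj : Injective fun s => Y (j s).succ :=
      hYm.injective.comp ((Fin.succ_injective n).comp hj.injective)
    have hii : ∀ s : Fin m, (i 0).succ < (i s.succ).succ := fun s =>
      Fin.succ_lt_succ_iff.2 (hi s.succ_pos)
    have hjj : ∀ s : Fin m, (j s.succ).succ < (j 0).succ := fun s =>
      Fin.succ_lt_succ_iff.2 (hj s.succ_pos)
    have hσb : σ (Y (j 0).succ) = Y (j 0).succ := (hfix _ fun s => Or.inr (hYm (hjj s))).1
    have hτa : τ (Y (i 0).succ) = Y (i 0).succ := (hfix _ fun s => Or.inl (hYm (hii s))).2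
    have hmono := monotone_comp hi' hj' hd
    have hsi := comp_snd_eq (fun s : Fin m => i s.succ) (fun s => j s.succ) d
      fun s => Or.inl (hii s)
    have hsj := comp_snd_eq (fun s : Fin m => i s.succ) (fun s => j s.succ) d
      fun s => Or.inr (hjj s)
    have hfi := (comp_fst_eq (fun s : Fin m => i s.succ) (fun s => j s.succ) d (p := i 0)
      fun s => Or.inl (hi s.succ_pos).le).1
    have hfj : partSize (muComp (fun s => i s.succ) (fun s => j s.succ) d) (j 0 + 1) =
        partSize d (j 0 + 1) := by
      rw [partSize, partSize]
      split_ifs with h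
      · refine (comp_fst_eq _ _ d fun s => Or.inr ?_).2
        have := hj s.succ_pos
        rw [Fin.lt_def] at this ⊢
        exact this.trans (Nat.lt_succ_self _)
      · rfl
    have hpi := lowerRows_piOp_comp_cycleIcc N r hmono.1 (hij 0 0)
      (fun q hq => (comp_snd_lt_of_lt hj hd q hq).1) ((hY _).trans hsi.1.symm)
      ((hY _).trans hsj.1.symm)
    have hmu := upperRows_muOp N r hmono.2 (hij 0 0)
      (fun q hq => (comp_snd_lt_of_gt hi hd q hq).2)
      (Fin.pos_iff_ne_zero.1 ((Fin.zero_le _).trans_lt (hYm (i 0).succ_pos)))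
      ((hY _).trans hsi.2.symm) ((hY _).trans hsj.2.symm)
      (fun q hq => (comp_snd_lt_of_lt hj hd q hq).2)
    rw [hfi, hsi.1, ← upperRows_apply_succ hd hY hd0, ← piComp_succ, hσ] at hpi
    have hl := lowerRows_apply (N := N) hd hY (j 0).succ
    rw [Fin.val_succ] at hl
    rw [hfj, hsj.2, ← hl, ← muComp_succ, hτ] at hmu
    set c := Fin.cycleIcc (Y (i 0).succ) (Y (j 0).succ) with hc
    refine ⟨σ * c⁻¹, τ * c, ?_, fun p hp => ?_, ?_, ?_⟩
    · rw [map_mul, map_mul, hs, Equiv.Perm.sign_inv]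
    · have hcp : c p = p := by
        rcases hp 0 with h | h
        · exact Fin.cycleIcc_of_lt h
        · exact Fin.cycleIcc_of_gt h
      have hcp' : c⁻¹ p = p := by rw [Equiv.Perm.inv_eq_iff_eq, hcp]
      have := hfix p fun s => hp s.succ
      rw [Equiv.Perm.mul_apply, Equiv.Perm.mul_apply, hcp, hcp']
      exact this
    · have h := update_comp_eq_of_injective (extend (fun s : Fin m => Y (j s.succ).succ)
        (fun s => upperRows N r d (Y (i s.succ).succ)) (lowerRows N r d)) σ.injective
        (Y (j 0).succ) (upperRows N r d (Y (i 0).succ))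
      rw [hσb] at h
      rw [extend_fin_succ hYj]
      rw [← h] at hpi
      funext p
      have := congrFun hpi (c⁻¹ p)
      rw [comp_apply, show c (c⁻¹ p) = p from c.apply_symm_apply p] at this
      rw [this]
      rfl
    · have h := update_comp_eq_of_injective (extend (fun s : Fin m => Y (i s.succ).succ)
        (fun s => lowerRows N r d (Y (j s.succ).succ)) (upperRows N r d)) τ.injective
        (Y (i 0).succ) (lowerRows N r d (Y (j 0).succ))
      rw [hτa] at h
      rw [extend_fin_succ hYi]
      rw [← h] at hmu
      rw [hmu]
      rfl

lemma upperRows_eq_lowerRows (hd : StrictMono d.2) (hY : ∀ q, ((Y q : ℕ) : ℤ) = d.2 q)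
    (hd0 : d.2 0 = 0) {p : Fin (r + 1)} (hp : p ∉ Set.range Y) :
    upperRows N r d p = lowerRows N r d p := by
  have hne : ∀ q, d.2 q ≠ (p : ℕ) := fun q h => hp ⟨q, by
    rw [← hY] at h
    exact Fin.ext (by exact_mod_cast h)⟩
  rw [upperRows, lowerRows, if_neg, partAt_eq_partAt hd.monotone (d' := d) (p := (p : ℕ))]
  · intro q
    have := hne q.succ
    omega
  · exact fun _ _ => rfl
  · rintro rfl
    exact hne 0 hd0

/-- Corner data with `e` added to the `k` largest part sizes. -/
def shiftParts (k : ℕ) (e : ℤ) (d : CornerData n) : CornerData n :=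
  (fun p => if (p : ℕ) < k then d.1 p + e else d.1 p, d.2)

variable {k : ℕ} (hkn : k ≤ n)

lemma partAt_shiftParts (hd : Monotone d.2) (hk : 1 ≤ k) (e : ℤ) (p : ℤ) :
    partAt (shiftParts k e d) p =
      partAt d p + if p < d.2 ⟨k, Nat.lt_succ_of_le hkn⟩ then e else 0 := by
  obtain ⟨k, rfl⟩ := Nat.exists_eq_add_of_le' hk
  refine partAt_eq_partAt_add hd (fun q => Iff.rfl) (fun c hc => ?_) fun h => ?_
  · have := hc ⟨k, hkn⟩
    rw [Fin.lt_def] at this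
    change (if (c : ℕ) < k + 1 then d.1 c + e else d.1 c) =
      d.1 c + if p < d.2 (Fin.succ ⟨k, hkn⟩) then e else 0
    split_ifs <;> simp at * <;> omega
  · rw [if_neg]
    exact not_lt.2 (h ⟨k, hkn⟩)

lemma exists_perm_cycle (hYm : StrictMono Y) : ∃ ρ : Equiv.Perm (Fin (r + 1)),
    (∀ t : Fin k, ρ (Y (Fin.castLE hkn t).castSucc) = Y (Fin.castLE hkn t).succ) ∧
      ρ (Y ⟨k, Nat.lt_succ_of_le hkn⟩) = Y 0 ∧
      (∀ p ∉ Set.range Y, ρ p = p) ∧ ∀ p, Y ⟨k, Nat.lt_succ_of_le hkn⟩ < p → ρ p = p := by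
  set K : Fin (n + 1) := ⟨k, Nat.lt_succ_of_le hkn⟩ with hK
  let c := Fin.cycleIcc 0 K
  let g : Fin (n + 1) ↪ Fin (r + 1) := ⟨Y, hYm.injective⟩
  have hg : ∀ t, c.viaFintypeEmbedding g (Y t) = Y (c t) := fun t =>
    Equiv.Perm.viaFintypeEmbedding_apply_image c g t
  have hp : ∀ p ∉ Set.range Y, c.viaFintypeEmbedding g p = p := fun p hp =>
    Equiv.Perm.viaFintypeEmbedding_apply_notMem_range c g hp
  refine ⟨c.viaFintypeEmbedding g, fun t => ?_, ?_, hp, fun p hpK => ?_⟩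
  · rw [hg, Fin.cycleIcc_of_ge_of_lt (Fin.zero_le _), Fin.coeSucc_eq_succ]
    exact t.2
  · rw [hg, Fin.cycleIcc_of_last (Fin.zero_le _)]
  · by_cases h : p ∈ Set.range Y
    · obtain ⟨t, rfl⟩ := h
      rw [hg, Fin.cycleIcc_of_gt (hYm.lt_iff_lt.1 hpK)]
    · exact hp p h

lemma exists_perm_rows_shiftParts (hd : StrictMono d.2) (hY : ∀ q, ((Y q : ℕ) : ℤ) = d.2 q)
    (hd0 : d.2 0 = 0) (hk : 1 ≤ k) :
    ∃ σ τ : Equiv.Perm (Fin (r + 1)), Equiv.Perm.sign σ = Equiv.Perm.sign τ ∧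
      upperRows N r (shiftParts k 1 d) = extend (fun t : Fin k => Y (Fin.castLE hkn t).succ)
        (fun t => lowerRows N r d (Y (Fin.castLE hkn t).castSucc)) (upperRows N r d) ∘ σ ∧
      lowerRows N r (shiftParts k (-1) d) =
        extend (fun t : Fin k => Y (Fin.castLE hkn t).castSucc)
          (fun t => upperRows N r d (Y (Fin.castLE hkn t).succ)) (lowerRows N r d) ∘ τ := by
  have hYm := strictMono_of_val_eq hd hY
  obtain ⟨ρ, hρ, hρK, hρY, hρgt⟩ := exists_perm_cycle hkn hYm
  set K : Fin (n + 1) := ⟨k, Nat.lt_succ_of_le hkn⟩ with hK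
  have hY0 : Y 0 = 0 := Fin.ext (by have := hY 0; rw [Fin.val_zero]; omega)
  have hinj : Injective fun t : Fin k => Y (Fin.castLE hkn t).castSucc := fun a b hab =>
    Fin.castLE_injective hkn (Fin.castSucc_injective _ (hYm.injective hab))
  have hinj' : Injective fun t : Fin k => Y (Fin.castLE hkn t).succ := fun a b hab =>
    Fin.castLE_injective hkn (Fin.succ_injective _ (hYm.injective hab))
  have hle : ∀ t : Fin k, Y (Fin.castLE hkn t).succ ≤ Y K := fun t => hYm.monotone t.2
  have hlt : ∀ t : Fin k, Y (Fin.castLE hkn t).castSucc < Y K := fun t => hYm t.2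
  have hpos : ∀ t : Fin k, Y (Fin.castLE hkn t).succ ≠ 0 := fun t => by
    rw [← hY0]
    exact hYm.injective.ne (Fin.succ_ne_zero _)
  have hval : ∀ q : Fin (r + 1), q < Y K → ((q + 1 : Fin (r + 1)) : ℕ) = q + 1 := fun q hq =>
    Fin.val_add_one_of_lt' (by omega)
  have hltK : ∀ q : Fin (r + 1), q < Y K ↔ ((q : ℕ) : ℤ) < d.2 K := fun q => by
    rw [← hY, Fin.lt_def, Nat.cast_lt]
  have hltK' : ∀ q : Fin (r + 1), q ≤ Y K ↔ ((q : ℕ) : ℤ) ≤ d.2 K := fun q => by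
    rw [← hY, Fin.le_def, Nat.cast_le]
  have hup : ∀ q : Fin (r + 1), q < Y K →
      upperRows N r (shiftParts k 1 d) (q + 1) = lowerRows N r d q := fun q hq => by
    rw [upperRows, lowerRows, if_neg (by rw [Fin.ext_iff, hval q hq]; simp),
      partAt_shiftParts hkn hd.monotone hk, ← hK, hval q hq, if_pos]
    · congr 1
      push_cast
      ring_nf
    · have := (hltK q).1 hq
      push_cast
      omega
  have hlow : ∀ q : Fin (r + 1), q < Y K →
      lowerRows N r (shiftParts k (-1) d) q = upperRows N r d (q + 1) := fun q hq => by
    rw [upperRows, lowerRows, if_neg (by rw [Fin.ext_iff, hval q hq]; simp),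
      partAt_shiftParts hkn hd.monotone hk, hval q hq, if_pos ((hltK q).1 hq)]
    congr 1
    push_cast
    ring_nf
  have hup' : ∀ q : Fin (r + 1), q = 0 ∨ Y K < q →
      upperRows N r (shiftParts k 1 d) q = upperRows N r d q := fun q hq => by
    rw [upperRows, upperRows]
    split_ifs with h
    · rfl
    · rw [partAt_shiftParts hkn hd.monotone hk, ← hK, if_neg, add_zero]
      have := (hltK' q).not.1 (not_le.2 (hq.resolve_left h))
      omega
  have hlow' : ∀ q : Fin (r + 1), Y K ≤ q →
      lowerRows N r (shiftParts k (-1) d) q = lowerRows N r d q := fun q hq => by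
    rw [lowerRows, lowerRows, partAt_shiftParts hkn hd.monotone hk,
      if_neg ((hltK q).not.1 (not_lt.2 hq)), add_zero]
  set c := Fin.cycleIcc 0 (Y K) with hc
  have hclt : ∀ q : Fin (r + 1), q < Y K → c q = q + 1 := fun q hq =>
    Fin.cycleIcc_of_ge_of_lt (Fin.zero_le _) hq
  have hcK : c (Y K) = 0 := Fin.cycleIcc_of_last (Fin.zero_le _)
  have hcgt : ∀ q : Fin (r + 1), Y K < q → c q = q := fun q hq => Fin.cycleIcc_of_gt hq
  have hKlt : ∀ t, t < K → ∃ s : Fin k, (Fin.castLE hkn s).castSucc = t := fun t ht =>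
    ⟨⟨t, ht⟩, rfl⟩
  have hKle : ∀ t, t ≠ 0 → t ≤ K → ∃ s : Fin k, (Fin.castLE hkn s).succ = t := fun t h0 ht => by
    obtain ⟨s, rfl⟩ := Fin.exists_succ_eq.2 h0
    exact ⟨⟨s, ht⟩, rfl⟩
  refine ⟨ρ * c⁻¹, ρ⁻¹ * c, ?_, ?_, ?_⟩
  · rw [map_mul, map_mul, Equiv.Perm.sign_inv, Equiv.Perm.sign_inv]
  · suffices h : upperRows N r (shiftParts k 1 d) ∘ c =
        extend (fun t : Fin k => Y (Fin.castLE hkn t).succ)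
          (fun t => lowerRows N r d (Y (Fin.castLE hkn t).castSucc)) (upperRows N r d) ∘ ρ by
      funext p
      have := congrFun h (c⁻¹ p)
      rwa [comp_apply, show c (c⁻¹ p) = p from c.apply_symm_apply p] at this
    funext q
    rw [comp_apply, comp_apply]
    rcases lt_trichotomy q (Y K) with hq | rfl | hq
    · rw [hclt q hq, hup q hq]
      by_cases hqY : q ∈ Set.range Y
      · obtain ⟨t, rfl⟩ := hqY
        obtain ⟨s, rfl⟩ := hKlt t (hYm.lt_iff_lt.1 hq)
        rw [hρ, hinj'.extend_apply]
      · rw [hρY q hqY, extend_apply' _ _ _ fun ⟨t, ht⟩ => hqY ⟨_, ht⟩,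
          upperRows_eq_lowerRows hd hY hd0 hqY]
    · rw [hcK, hρK, hup' 0 (Or.inl rfl), hY0, extend_apply' _ _ _ fun ⟨t, ht⟩ => hpos t ht]
    · rw [hcgt q hq, hρgt q hq, hup' q (Or.inr hq),
        extend_apply' _ _ _ fun ⟨t, ht⟩ => (hle t).not_gt (ht ▸ hq)]
  · funext q
    rw [comp_apply, Equiv.Perm.mul_apply]
    rcases lt_trichotomy q (Y K) with hq | rfl | hq
    · rw [hclt q hq, hlow q hq]
      by_cases hqY : q + 1 ∈ Set.range Y
      · obtain ⟨t, ht⟩ := hqY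
        have hv := hval q hq
        rw [← ht] at hv
        obtain ⟨s, rfl⟩ := hKle t (by rintro rfl; rw [hY0, Fin.val_zero] at hv; omega)
          (hYm.le_iff_le.1 (by rw [Fin.le_def, hv]; exact hq))
        rw [← ht, Equiv.Perm.inv_eq_iff_eq.2 (hρ s).symm, hinj.extend_apply]
      · rw [Equiv.Perm.inv_eq_iff_eq.2 (hρY _ hqY).symm,
          extend_apply' _ _ _ fun ⟨t, ht⟩ => hqY ⟨_, ht⟩, upperRows_eq_lowerRows hd hY hd0 hqY]
    · rw [hcK, Equiv.Perm.inv_eq_iff_eq.2 (hY0.symm.trans hρK.symm), hlow' _ le_rfl,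
        extend_apply' _ _ _ fun ⟨t, ht⟩ => (hlt t).ne ht]
    · rw [hcgt q hq, Equiv.Perm.inv_eq_iff_eq.2 (hρgt q hq).symm, hlow' q hq.le,
        extend_apply' _ _ _ fun ⟨t, ht⟩ => (hlt t).not_gt (ht ▸ hq)]

end Rows

lemma rowDet_mul_rowDet_of_comp {A ι : Type*} [CommRing A] [Fintype ι] [DecidableEq ι]
    {P Q P' Q' : ι → ι → A} {σ τ : Equiv.Perm ι} (h : Equiv.Perm.sign σ = Equiv.Perm.sign τ)
    (hP : P = P' ∘ σ) (hQ : Q = Q' ∘ τ) : rowDet P * rowDet Q = rowDet P' * rowDet Q' := by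
  rw [hP, hQ, rowDet_comp_perm, rowDet_comp_perm, h, mul_mul_mul_comm, ← Int.cast_mul,
    ← Units.val_mul, Int.units_mul_self, Units.val_one, Int.cast_one, one_mul]

/-- The product of the Schur functions of `λ + ω` and `λ - ω` as an alternating sum. -/
theorem schurOf_shiftParts_mul_schurOf_shiftParts {d : CornerData n} (hd : StrictMono d.2)
    (hd0 : d.2 0 = 0) {k : ℕ} (hk : 1 ≤ k) (hkn : k ≤ n) :
    schurOf N (shiftParts k 1 d) * schurOf N (shiftParts k (-1) d) =
      ∑ m ∈ Finset.range (n + 1), ∑ ij ∈ nestedPairs n k m,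
        (-1) ^ m * (schurOf N (piComp ij.1 ij.2 d) * schurOf N (muComp ij.1 ij.2 d)) := by
  have hnn : ∀ q, 0 ≤ d.2 q := fun q => hd0 ▸ hd.monotone (Fin.zero_le q)
  have hle : ∀ q, d.2 q ≤ d.2 (Fin.last n) := fun q => hd.monotone (Fin.le_last q)
  obtain ⟨r, hr⟩ := Int.eq_ofNat_of_zero_le (hnn (Fin.last n))
  have hlt : ∀ q, (d.2 q).toNat < r + 1 := fun q => by have := hle q; omega
  let Y : Fin (n + 1) → Fin (r + 1) := fun q => ⟨(d.2 q).toNat, hlt q⟩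
  have hY : ∀ q, ((Y q : ℕ) : ℤ) = d.2 q := fun q => Int.toNat_of_nonneg (hnn q)
  obtain ⟨σ, τ, hs, hσ, hτ⟩ := exists_perm_rows_shiftParts (N := N) hkn hd hY hd0 hk
  rw [schurOf_eq_rowDet_upperRows N r (d := shiftParts k 1 d) hd.monotone hr.le,
    schurOf_eq_rowDet_lowerRows N r (d := shiftParts k (-1) d) hd.monotone
      (hr.le.trans (lt_add_one _).le), rowDet_mul_rowDet_of_comp hs hσ hτ,
    rowDet_mul_rowDet_eq_sum_nestedPairs hkn hk (strictMono_of_val_eq hd hY).injective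
      fun p hp => upperRows_eq_lowerRows hd hY hd0 hp]
  refine Finset.sum_congr rfl fun m _ => Finset.sum_congr rfl fun ij hij => ?_
  obtain ⟨h1, h2, h3, h4⟩ := mem_nestedPairs.1 hij
  obtain ⟨σ, τ, hs, -, hσ, hτ⟩ := exists_perm_rows_comp (N := N) hd hY (hnn 0) h1 h2 fun s t => by
    have := h3 s
    have := h4 t
    rw [Fin.le_def]
    omega
  have hmono := monotone_comp h1 h2 hd
  have hlast := piComp_snd_last_le (i := ij.1) h2 d
  have hlast' := muComp_snd_le ij.1 ij.2 d (Fin.last n)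
  rw [schurOf_eq_rowDet_lowerRows N r hmono.1 (by omega),
    schurOf_eq_rowDet_upperRows N r hmono.2 (by omega), rowDet_mul_rowDet_of_comp hs hσ hτ,
    mul_assoc]

end Corner

/-- **Kleber's theorem.** Let `λ` be a partition with `n ≥ 1` outside corners,
encoded by its corner data `x_1 > x_2 > … > x_n > 0` and
`0 = y_0 < y_1 < … < y_n`, so `λ = (x_1^{y_1−y_0}, …, x_n^{y_n−y_{n−1}})`.
Fix `1 ≤ k ≤ n` (and `l = y_k`).  Then
`s_λ · s_λ = s_{λ+ω_l} · s_{λ−ω_l}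
  + Σ_{m ≥ 1} Σ_{1 ≤ i_1 < … < i_m ≤ k, k ≤ j_m < … < j_1 ≤ n} (−1)^{m−1}
      s_{π^{i_1,…,i_m}_{j_1,…,j_m}(λ)} · s_{μ^{i_1,…,i_m}_{j_1,…,j_m}(λ)}`,
where `λ ± ω_l` adds `±1` to each of `x_1, …, x_k`, and
`π^{i_1,…,i_m}_{j_1,…,j_m} = π^{i_1}_{j_1} ∘ … ∘ π^{i_m}_{j_m}` (similarly `μ`).
Below, a pair `ij` encodes the (`0`-indexed) sequences `i_1 < … < i_m` (via the
strictly increasing `ij.1`, with values `< k`) and `j_1 > … > j_m` (via the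
strictly decreasing `ij.2`, with values `≥ k − 1`); the terms with `m > n`
vanish since then no such sequences exist. -/
theorem kleber (N : ℕ) (hN : 1 ≤ N) (n : ℕ) (hn : 1 ≤ n)
    (x : Fin n → ℤ) (y : Fin (n + 1) → ℤ)
    (hx : StrictAnti x) (hxpos : ∀ p, 0 < x p)
    (hy : StrictMono y) (hy0 : y 0 = 0)
    (k : ℕ) (hk1 : 1 ≤ k) (hkn : k ≤ n) :
    schurOf N (x, y) * schurOf N (x, y)
    = schurOf N (fun p => if (p : ℕ) < k then x p + 1 else x p, y) *
        schurOf N (fun p => if (p : ℕ) < k then x p - 1 else x p, y)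
      + ∑ m ∈ Finset.Icc 1 n,
          ∑ ij ∈ Finset.univ.filter
              (fun ij : (Fin m → Fin n) × (Fin m → Fin n) =>
                StrictMono ij.1 ∧ StrictAnti ij.2 ∧
                  (∀ t, (ij.1 t : ℕ) + 1 ≤ k) ∧ (∀ t, k ≤ (ij.2 t : ℕ) + 1)),
            (-1 : MvPolynomial (Fin N) ℤ) ^ (m - 1) *
              schurOf N
                (opComp m (fun t => piOp ((ij.1 t : ℕ) + 1) ((ij.2 t : ℕ) + 1)) (x, y)) *
              schurOf N
                (opComp m (fun t => muOp ((ij.1 t : ℕ) + 1) ((ij.2 t : ℕ) + 1)) (x, y)) := by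
  have hkey := schurOf_shiftParts_mul_schurOf_shiftParts N (d := (x, y)) hy hy0 hk1 hkn
  have hrange : Finset.range (n + 1) = insert 0 (Finset.Icc 1 n) := by
    ext m
    simp only [Finset.mem_range, Finset.mem_insert, Finset.mem_Icc]
    omega
  have hzero : nestedPairs n k 0 = {default} := by
    ext ij
    simpa [mem_nestedPairs, Subsingleton.elim ij default] using
      ⟨fun s => s.elim0, fun s => s.elim0⟩
  rw [hrange, Finset.sum_insert (by simp), hzero, Finset.sum_singleton, pow_zero, one_mul] at hkey
  have hneg : ∀ m ∈ Finset.Icc 1 n, ∑ ij ∈ nestedPairs n k m, (-1) ^ m *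
      (schurOf N (piComp ij.1 ij.2 (x, y)) * schurOf N (muComp ij.1 ij.2 (x, y))) =
      -∑ ij ∈ nestedPairs n k m, (-1) ^ (m - 1) * schurOf N (piComp ij.1 ij.2 (x, y)) *
        schurOf N (muComp ij.1 ij.2 (x, y)) := fun m hm => by
    obtain ⟨m, rfl⟩ := Nat.exists_eq_add_of_le' (Finset.mem_Icc.1 hm).1
    rw [← Finset.sum_neg_distrib]
    refine Finset.sum_congr rfl fun ij _ => ?_
    rw [Nat.add_sub_cancel, pow_succ]
    ring
  rw [Finset.sum_congr rfl hneg, Finset.sum_neg_distrib, ← sub_eq_add_neg] at hkey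
  exact eq_add_of_sub_eq hkey.symm
end

section
/- Jacobi–Trudi identity: Let N ≥ 1 and let λ = (λ_1 ≥ λ_2 ≥ … ≥ λ_r ≥ 0) be a partition of length r. Let s_λ(x_1,…,x_N) denote the generating polynomial of N-semistandard Young tableaux of shape λ: s_λ = Σ_T Π_{k=1}^{N} x_k^{m(T,k)}, where the sum is over all fillings T of the Ferrers board of λ (r left-justified rows with λ_i cells in row i) with entries from {1,…,N} that weakly increase along rows and strictly increase down columns, and m(T,k) is the number of entries of T equal to k. Then s_λ(x_1,…,x_N) equals the determinant of the r×r matrix whose (i,j) entry is h_{λ_i − i + j}, where h_m is the complete homogeneous symmetric polynomial of degree m in x_1,…,x_N (h_0 = 1, h_m = 0 for m < 0). -/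
open scoped Classical

open Finset

section CompleteHomogeneous

variable {R σ : Type*} [CommRing R] [DecidableEq σ] (x : σ → R)

/-- The complete homogeneous symmetric polynomial of integral degree `m`, evaluated at the
values `x a` for `a` in the finite set `s`. -/
noncomputable def completeHom (s : Finset σ) (m : ℤ) : R :=
  if 0 ≤ m then ∑ t ∈ s.sym m.toNat, ((t : Multiset σ).map x).prod else 0

lemma completeHom_of_neg (s : Finset σ) {m : ℤ} (hm : m < 0) : completeHom x s m = 0 :=
  if_neg (not_le.2 hm)

lemma completeHom_empty (m : ℤ) : completeHom x ∅ m = if m = 0 then 1 else 0 := by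
  unfold completeHom
  rcases lt_trichotomy m 0 with hm | rfl | hm
  · rw [if_neg (by omega), if_neg (by omega)]
  · simp only [le_refl, if_true, Int.toNat_zero, sym_zero, sum_singleton]
    exact Multiset.prod_zero
  · obtain ⟨k, rfl⟩ : ∃ k : ℕ, m = (k + 1 : ℕ) := ⟨m.toNat - 1, by omega⟩
    rw [if_pos (by omega), if_neg (by omega), Int.toNat_natCast, sym_empty, sum_empty]

lemma sum_sym_insert {a : σ} {s : Finset σ} (h : a ∉ s) (n : ℕ) :
    ∑ t ∈ (insert a s).sym n, ((t : Multiset σ).map x).prod =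
      ∑ i : Fin (n + 1), x a ^ (i : ℕ) * ∑ t ∈ s.sym (n - i), ((t : Multiset σ).map x).prod := by
  rw [← sum_coe_sort ((insert a s).sym n), ← (symInsertEquiv h).symm.sum_comp, Fintype.sum_sigma]
  refine sum_congr rfl fun i _ ↦ ?_
  rw [mul_sum, ← sum_coe_sort (s.sym (n - i))]
  refine sum_congr rfl fun t _ ↦ ?_
  simp [symInsertEquiv, Sym.coe_fill, Sym.coe_replicate, mul_comm]

lemma completeHom_insert {a : σ} {s : Finset σ} (h : a ∉ s) (m : ℤ) :
    completeHom x (insert a s) m =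
      completeHom x s m + x a * completeHom x (insert a s) (m - 1) := by
  rcases lt_or_ge m 0 with hm | hm
  · simp [completeHom_of_neg x _ hm, completeHom_of_neg x _ (show m - 1 < 0 by omega)]
  obtain ⟨k, rfl⟩ := Int.eq_ofNat_of_zero_le hm
  rcases k with _ | k
  · simp [completeHom]
  · have hk : ((k + 1 : ℕ) : ℤ) - 1 = k := by omega
    rw [hk]
    simp only [completeHom, if_pos (Int.natCast_nonneg _), Int.toNat_natCast]
    rw [sum_sym_insert x h, sum_sym_insert x h, Fin.sum_univ_succ]
    congr 1
    · simp
    · rw [mul_sum]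
      refine sum_congr rfl fun i _ ↦ ?_
      rw [Fin.val_succ, pow_succ', mul_assoc, Nat.add_sub_add_right]

lemma completeHom_insert_sub {a : σ} {s : Finset σ} (h : a ∉ s) (m : ℤ) (d : ℕ) :
    completeHom x (insert a s) m =
      (∑ k ∈ range d, x a ^ k * completeHom x s (m - k)) +
        x a ^ d * completeHom x (insert a s) (m - d) := by
  induction d with
  | zero => simp
  | succ d ih =>
    rw [ih, sum_range_succ, completeHom_insert x h (m - d)]
    push_cast
    rw [show m - (d + 1 : ℤ) = m - d - 1 by ring]
    ring

lemma completeHom_insert_sub_Icc {a : σ} {s : Finset σ} (h : a ∉ s) {p q : ℕ} (hpq : p ≤ q)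
    (e : ℤ) :
    completeHom x (insert a s) (q + e) =
      (∑ k ∈ Icc p q, x a ^ (q - k) * completeHom x s (k + e)) +
        x a ^ (q - p + 1) * completeHom x (insert a s) (p - 1 + e) := by
  rw [completeHom_insert_sub x h _ (q - p + 1)]
  congr 1
  · refine sum_nbij' (fun k ↦ q - k) (fun k ↦ q - k) ?_ ?_ ?_ ?_ ?_
    · simp only [mem_range, mem_Icc]; omega
    · simp only [mem_range, mem_Icc]; omega
    · simp only [mem_range]; omega
    · simp only [mem_Icc]; omega
    · intro k hk
      rw [mem_range] at hk
      congr 2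
      · omega
      · omega
  · congr 2
    omega

/-- The determinant in the Jacobi–Trudi identity. -/
noncomputable def jacobiTrudiDet (s : Finset σ) {r : ℕ} (lam : Fin r → ℕ) : R :=
  (Matrix.of fun i j : Fin r ↦ completeHom x s ((lam i : ℤ) - (i : ℕ) + (j : ℕ))).det

/-- The part following the `i`-th one, which is `0` after the last part. -/
def nextPart {r : ℕ} (lam : Fin r → ℕ) (i : Fin r) : ℕ :=
  if h : (i : ℕ) + 1 < r then lam ⟨i + 1, h⟩ else 0

lemma nextPart_le {r : ℕ} {lam : Fin r → ℕ} (hlam : Antitone lam) (i : Fin r) :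
    nextPart lam i ≤ lam i := by
  unfold nextPart
  split_ifs with h
  · exact hlam (Fin.le_def.2 (Nat.le_succ _))
  · exact Nat.zero_le _

lemma le_nextPart {r : ℕ} {lam : Fin r → ℕ} (hlam : Antitone lam) {i i' : Fin r} (h : i < i') :
    lam i' ≤ nextPart lam i := by
  have h' : (i : ℕ) + 1 < r := by have := i'.2; rw [Fin.lt_def] at h; omega
  rw [nextPart, dif_pos h']
  exact hlam (Fin.le_def.2 (Nat.succ_le_of_lt h))

/-- The sequences interlacing with `lam`. -/
def interlacing {r : ℕ} (lam : Fin r → ℕ) : Finset (Fin r → ℕ) :=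
  Fintype.piFinset fun i ↦ Icc (nextPart lam i) (lam i)

lemma mem_interlacing {r : ℕ} {lam μ : Fin r → ℕ} :
    μ ∈ interlacing lam ↔ ∀ i, nextPart lam i ≤ μ i ∧ μ i ≤ lam i := by
  simp [interlacing]

lemma antitone_of_mem_interlacing {r : ℕ} {lam μ : Fin r → ℕ} (hlam : Antitone lam)
    (hμ : μ ∈ interlacing lam) : Antitone μ := by
  rw [mem_interlacing] at hμ
  intro i i' h
  rcases h.eq_or_lt with rfl | h
  · rfl
  · exact (hμ i').2.trans ((le_nextPart hlam h).trans (hμ i).1)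

lemma jacobiTrudiDet_empty {r : ℕ} {lam : Fin r → ℕ} (hlam : Antitone lam) :
    jacobiTrudiDet x ∅ lam = if lam = 0 then 1 else 0 := by
  unfold jacobiTrudiDet
  split_ifs with h
  · subst h
    convert Matrix.det_one (n := Fin r) (R := R)
    ext i j
    simp only [Matrix.of_apply, completeHom_empty, Matrix.one_apply, Pi.zero_apply, Fin.ext_iff]
    congr 1
    apply propext
    omega
  · obtain ⟨i, hi⟩ := Function.ne_iff.1 h
    have hi : lam i ≠ 0 := hi
    have : lam i ≤ lam ⟨0, i.pos⟩ := hlam (Fin.le_def.2 (Nat.zero_le _))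
    refine Matrix.det_eq_zero_of_row_eq_zero ⟨0, i.pos⟩ fun j ↦ ?_
    rw [Matrix.of_apply, completeHom_empty, if_neg]
    simp only [CharP.cast_eq_zero]
    omega

lemma jacobiTrudiDet_eq_det_sum {a : σ} {s : Finset σ} (h : a ∉ s) {r : ℕ} {lam : Fin r → ℕ}
    (hlam : Antitone lam) :
    jacobiTrudiDet x (insert a s) lam =
      (Matrix.of fun i j : Fin r ↦ ∑ k ∈ Icc (nextPart lam i) (lam i),
        x a ^ (lam i - k) * completeHom x s ((k : ℤ) - (i : ℕ) + (j : ℕ))).det := by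
  rcases r with _ | r
  · simp [jacobiTrudiDet]
  unfold jacobiTrudiDet
  rw [← Matrix.det_submatrix_equiv_self Fin.revPerm, eq_comm,
    ← Matrix.det_submatrix_equiv_self Fin.revPerm, eq_comm]
  have key (i j : Fin (r + 1)) := completeHom_insert_sub_Icc x h (nextPart_le hlam i)
    (-(i : ℕ) + (j : ℕ) : ℤ)
  simp only [← add_assoc, ← sub_eq_add_neg] at key
  refine Matrix.det_eq_of_forall_row_eq_smul_add_pred
    (fun i ↦ x a ^ (lam (Fin.rev i.succ) - nextPart lam (Fin.rev i.succ) + 1))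
    (fun j ↦ ?_) (fun i j ↦ ?_)
  · simp only [Matrix.submatrix_apply, Matrix.of_apply, Fin.revPerm_apply]
    rw [key, add_eq_left, completeHom_of_neg, mul_zero]
    simp [nextPart]
    omega
  · simp only [Matrix.submatrix_apply, Matrix.of_apply, Fin.revPerm_apply]
    rw [key]
    have hi : ((Fin.rev i.castSucc : Fin (r + 1)) : ℕ) = (Fin.rev i.succ : Fin (r + 1)) + 1 := by
      simp [Fin.val_rev]; omega
    have hn : nextPart lam (Fin.rev i.succ) = lam (Fin.rev i.castSucc) := by
      rw [nextPart, dif_pos (by rw [← hi]; exact Fin.is_lt _)]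
      exact congrArg lam (Fin.ext hi.symm)
    congr 3
    rw [hn, hi]
    push_cast
    ring

/-- The branching rule for Jacobi–Trudi determinants. -/
lemma jacobiTrudiDet_insert {a : σ} {s : Finset σ} (h : a ∉ s) {r : ℕ} {lam : Fin r → ℕ}
    (hlam : Antitone lam) :
    jacobiTrudiDet x (insert a s) lam =
      ∑ μ ∈ interlacing lam, (∏ i, x a ^ (lam i - μ i)) * jacobiTrudiDet x s μ := by
  rw [jacobiTrudiDet_eq_det_sum x h hlam]
  have := (Matrix.detRowAlternating (n := Fin r) (R := R)).toMultilinearMap.map_sum_finset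
    (fun i (k : ℕ) ↦ x a ^ (lam i - k) •
      fun j : Fin r ↦ completeHom x s ((k : ℤ) - (i : ℕ) + (j : ℕ)))
    (fun i ↦ Icc (nextPart lam i) (lam i))
  simp only [MultilinearMap.map_smul_univ] at this
  convert this using 1
  · change _ = Matrix.det _
    congr 1
    ext i j
    simp [Finset.sum_apply]
  · rfl

end CompleteHomogeneous

section Tableaux

lemma lt_card_filter_iff {M : ℕ} {p : Fin M → Prop} [DecidablePred p]
    (hp : ∀ c c', c ≤ c' → p c' → p c) (c : Fin M) : (c : ℕ) < #{c | p c} ↔ p c := by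
  constructor
  · intro hc
    by_contra hpc
    refine absurd hc (not_lt.2 ((card_le_card fun d hd ↦ ?_).trans_eq (Fin.card_Iio c)))
    rw [mem_Iio]
    exact lt_of_not_ge fun hcd ↦ hpc (hp _ _ hcd (mem_filter.1 hd).2)
  · intro hpc
    refine Nat.lt_of_succ_le ((Fin.card_Iic c).symm.trans_le (card_le_card fun d hd ↦ ?_))
    exact mem_filter.2 ⟨mem_univ _, hp _ _ (mem_Iic.1 hd) hpc⟩

variable {r M K : ℕ}

/-- Semistandard tableaux of shape `lam` with entries less than `n`, as fillings of an
`r × M` rectangle by elements of `Fin K` that vanish outside the board. -/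
structure IsTableau (n : ℕ) (lam : Fin r → ℕ) (T : Fin r → Fin M → Fin K) : Prop where
  row : ∀ (i : Fin r) (c c' : Fin M), c ≤ c' → (c' : ℕ) < lam i → T i c ≤ T i c'
  col : ∀ (i i' : Fin r) (c : Fin M), i < i' → (c : ℕ) < lam i' → T i c < T i' c
  zero : ∀ (i : Fin r) (c : Fin M), lam i ≤ (c : ℕ) → (T i c : ℕ) = 0
  lt : ∀ (i : Fin r) (c : Fin M), (c : ℕ) < lam i → (T i c : ℕ) < n

/-- The product of the values of `x` at the entries of a tableau of shape `lam`. -/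
noncomputable def tableauWeight {R : Type*} [CommRing R] (x : Fin K → R) (lam : Fin r → ℕ)
    (T : Fin r → Fin M → Fin K) : R :=
  ∏ i, ∏ c : Fin M, if (c : ℕ) < lam i then x (T i c) else 1

/-- The shape formed by the entries less than `n` of a tableau of shape `lam`. -/
noncomputable def innerShape (n : ℕ) (lam : Fin r → ℕ) (T : Fin r → Fin M → Fin K) (i : Fin r) :
    ℕ :=
  #{c : Fin M | (c : ℕ) < lam i ∧ (T i c : ℕ) < n}

/-- The restriction of a filling to the shape `μ`. -/
def restrictFilling [NeZero K] (μ : Fin r → ℕ) (T : Fin r → Fin M → Fin K) (i : Fin r)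
    (c : Fin M) : Fin K :=
  if (c : ℕ) < μ i then T i c else 0

/-- The extension of a filling of the shape `μ` to the shape `lam` by the constant `a`. -/
def extendFilling [NeZero K] (a : Fin K) (lam μ : Fin r → ℕ) (T : Fin r → Fin M → Fin K)
    (i : Fin r) (c : Fin M) : Fin K :=
  if (c : ℕ) < μ i then T i c else if (c : ℕ) < lam i then a else 0

lemma IsTableau.lt_innerShape_iff {n m : ℕ} {lam : Fin r → ℕ} {T : Fin r → Fin M → Fin K}
    (hT : IsTableau m lam T) (i : Fin r) (c : Fin M) :
    (c : ℕ) < innerShape n lam T i ↔ (c : ℕ) < lam i ∧ (T i c : ℕ) < n := by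
  refine lt_card_filter_iff (p := fun c : Fin M ↦ (c : ℕ) < lam i ∧ (T i c : ℕ) < n) ?_ c
  intro c c' h ⟨h1, h2⟩
  exact ⟨(Fin.le_def.1 h).trans_lt h1, (Fin.le_def.1 (hT.row i c c' h h1)).trans_lt h2⟩

lemma innerShape_le_card {n : ℕ} {lam : Fin r → ℕ} {T : Fin r → Fin M → Fin K} (i : Fin r) :
    innerShape n lam T i ≤ M :=
  (card_le_univ _).trans_eq (Fintype.card_fin M)

lemma IsTableau.innerShape_mem_interlacing {n : ℕ} {lam : Fin r → ℕ} (hlam : Antitone lam)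
    (hM : ∀ i, lam i ≤ M) {T : Fin r → Fin M → Fin K} (hT : IsTableau (n + 1) lam T) :
    innerShape n lam T ∈ interlacing lam := by
  rw [mem_interlacing]
  refine fun i ↦ ⟨?_, ?_⟩ <;> by_contra! h
  · have hn : ∃ h : (i : ℕ) + 1 < r, nextPart lam i = lam ⟨i + 1, h⟩ := by
      unfold nextPart at h ⊢
      split_ifs at h ⊢ with h'
      · exact ⟨h', rfl⟩
      · omega
    obtain ⟨hi, hn⟩ := hn
    rw [hn] at h
    have hc := h.trans_le (hM _)
    refine lt_irrefl _ ((hT.lt_innerShape_iff (n := n) i ⟨_, hc⟩).2 ⟨?_, ?_⟩)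
    · exact h.trans_le (hlam (Fin.le_def.2 (Nat.le_succ _)))
    · have h1 := Fin.lt_def.1
        (hT.col i ⟨i + 1, hi⟩ ⟨_, hc⟩ (Fin.lt_def.2 (Nat.lt_succ_self _)) h)
      have h2 := hT.lt ⟨i + 1, hi⟩ ⟨_, hc⟩ h
      omega
  · exact lt_irrefl _ ((hT.lt_innerShape_iff i ⟨lam i, h.trans_le (innerShape_le_card i)⟩).1 h).1

lemma IsTableau.restrictFilling [NeZero K] {n : ℕ} {lam : Fin r → ℕ} (hlam : Antitone lam)
    (hM : ∀ i, lam i ≤ M) {T : Fin r → Fin M → Fin K} (hT : IsTableau (n + 1) lam T) :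
    IsTableau n (innerShape n lam T) (restrictFilling (innerShape n lam T) T) := by
  have hanti := antitone_of_mem_interlacing hlam (hT.innerShape_mem_interlacing hlam hM)
  constructor
  · intro i c c' h h'
    rw [_root_.restrictFilling, _root_.restrictFilling, if_pos h',
      if_pos ((Fin.le_def.1 h).trans_lt h')]
    exact hT.row i c c' h ((hT.lt_innerShape_iff i c').1 h').1
  · intro i i' c h h'
    rw [_root_.restrictFilling, _root_.restrictFilling, if_pos h',
      if_pos (h'.trans_le (hanti h.le))]
    exact hT.col i i' c h ((hT.lt_innerShape_iff i' c).1 h').1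
  · intro i c h
    rw [_root_.restrictFilling, if_neg h.not_gt, Fin.val_zero]
  · intro i c h
    rw [_root_.restrictFilling, if_pos h]
    exact ((hT.lt_innerShape_iff i c).1 h).2

lemma IsTableau.extendFilling [NeZero K] {a : Fin K} {lam μ : Fin r → ℕ} (hlam : Antitone lam)
    (hμ : μ ∈ interlacing lam) {T : Fin r → Fin M → Fin K} (hT : IsTableau a μ T) :
    IsTableau (a + 1) lam (extendFilling a lam μ T) := by
  have hle := mem_interlacing.1 hμ
  constructor
  · intro i c c' h h'
    have h1 := Fin.le_def.1 h
    have h2 := hT.row i c c' h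
    have h3 := hT.lt i c
    simp only [_root_.extendFilling, Fin.le_def] at h2 ⊢
    split_ifs <;> omega
  · intro i i' c h h'
    have h1 := (le_nextPart hlam h).trans (hle i).1
    have h2 := hT.col i i' c h
    have h3 := hT.lt i c
    simp only [_root_.extendFilling, Fin.lt_def] at h2 ⊢
    split_ifs <;> omega
  · intro i c h
    have := (hle i).2
    simp only [_root_.extendFilling]
    rw [if_neg (by omega), if_neg (by omega), Fin.val_zero]
  · intro i c h
    have h3 := hT.lt i c
    simp only [_root_.extendFilling]
    split_ifs <;> omega

lemma innerShape_extendFilling [NeZero K] {a : Fin K} {lam μ : Fin r → ℕ} (hlam : Antitone lam)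
    (hM : ∀ i, lam i ≤ M) (hμ : μ ∈ interlacing lam) {T : Fin r → Fin M → Fin K}
    (hT : IsTableau a μ T) : innerShape a lam (extendFilling a lam μ T) = μ := by
  have hle := mem_interlacing.1 hμ
  have key (i : Fin r) (c : Fin M) :
      (c : ℕ) < innerShape a lam (extendFilling a lam μ T) i ↔ (c : ℕ) < μ i := by
    rw [(hT.extendFilling hlam hμ).lt_innerShape_iff]
    have h2 := (hle i).2
    have h3 := hT.lt i c
    simp only [extendFilling]
    split_ifs <;> omega
  funext i
  have hμM := (hle i).2.trans (hM i)
  have hsM : innerShape a lam (extendFilling a lam μ T) i ≤ M := innerShape_le_card i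
  rcases lt_trichotomy (innerShape a lam (extendFilling a lam μ T) i) (μ i) with h | h | h
  · exact absurd ((key i ⟨_, h.trans_le hμM⟩).2 h) (lt_irrefl _)
  · exact h
  · exact absurd ((key i ⟨_, h.trans_le hsM⟩).1 h) (lt_irrefl _)

lemma restrictFilling_extendFilling [NeZero K] {a : Fin K} {lam μ : Fin r → ℕ}
    {n : ℕ} {T : Fin r → Fin M → Fin K} (hT : IsTableau n μ T) :
    restrictFilling μ (extendFilling a lam μ T) = T := by
  funext i c
  have h := hT.zero i c
  simp only [restrictFilling, extendFilling, Fin.ext_iff]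
  split_ifs
  · rfl
  · rw [h (by omega), Fin.val_zero]

lemma extendFilling_restrictFilling [NeZero K] {a : Fin K} {lam : Fin r → ℕ}
    {T : Fin r → Fin M → Fin K} (hT : IsTableau (a + 1) lam T) :
    extendFilling a lam (innerShape a lam T) (restrictFilling (innerShape a lam T) T) = T := by
  funext i c
  have h1 := hT.lt_innerShape_iff (n := a) i c
  have h2 := hT.lt i c
  have h3 := hT.zero i c
  simp only [restrictFilling, extendFilling, Fin.ext_iff]
  split_ifs
  · rfl
  · omega
  · rw [h3 (by omega), Fin.val_zero]

variable {R : Type*} [CommRing R] (x : Fin K → R)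

lemma tableauWeight_extendFilling [NeZero K] {a : Fin K} {lam μ : Fin r → ℕ}
    (hM : ∀ i, lam i ≤ M) (hμ : μ ∈ interlacing lam) (T : Fin r → Fin M → Fin K) :
    tableauWeight x lam (extendFilling a lam μ T) =
      (∏ i, x a ^ (lam i - μ i)) * tableauWeight x μ T := by
  unfold tableauWeight
  rw [← prod_mul_distrib]
  refine prod_congr rfl fun i _ ↦ ?_
  have hi := (mem_interlacing.1 hμ i).2
  have hcard : #{c : Fin M | μ i ≤ (c : ℕ) ∧ (c : ℕ) < lam i} = lam i - μ i := by
    rw [← Nat.card_Ico]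
    refine card_nbij (fun c ↦ (c : ℕ)) ?_ ?_ ?_
    · intro c hc
      simpa using hc
    · exact Fin.val_injective.injOn
    · intro k hk
      have hk := mem_Ico.1 (mem_coe.1 hk)
      exact ⟨⟨k, hk.2.trans_le (hM i)⟩, by simpa using hk, rfl⟩
  rw [← hcard, ← prod_const, prod_filter, ← prod_mul_distrib]
  refine prod_congr rfl fun c _ ↦ ?_
  unfold extendFilling
  by_cases h1 : (c : ℕ) < μ i
  · simp [h1, h1.trans_le hi]
  · by_cases h2 : (c : ℕ) < lam i <;> simp [h1, h2, not_lt.1 h1]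

/-- The branching rule for generating functions of tableaux. -/
lemma sum_tableauWeight_succ [NeZero K] (a : Fin K) {lam : Fin r → ℕ} (hlam : Antitone lam)
    (hM : ∀ i, lam i ≤ M) :
    ∑ T : Fin r → Fin M → Fin K with IsTableau (a + 1) lam T, tableauWeight x lam T =
      ∑ μ ∈ interlacing lam, (∏ i, x a ^ (lam i - μ i)) *
        ∑ T : Fin r → Fin M → Fin K with IsTableau a μ T, tableauWeight x μ T := by
  simp_rw [mul_sum]
  rw [sum_sigma']
  refine sum_bij'
    (fun T _ ↦ ⟨innerShape a lam T, restrictFilling (innerShape a lam T) T⟩)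
    (fun p _ ↦ extendFilling a lam p.1 p.2) ?_ ?_ ?_ ?_ ?_
  · intro T hT
    have hT := (mem_filter.1 hT).2
    exact mem_sigma.2 ⟨hT.innerShape_mem_interlacing hlam hM,
      mem_filter.2 ⟨mem_univ _, hT.restrictFilling hlam hM⟩⟩
  · rintro ⟨μ, T⟩ hp
    obtain ⟨hμ, hT⟩ := mem_sigma.1 hp
    exact mem_filter.2 ⟨mem_univ _, (mem_filter.1 hT).2.extendFilling hlam hμ⟩
  · intro T hT
    exact extendFilling_restrictFilling (mem_filter.1 hT).2
  · rintro ⟨μ, T⟩ hp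
    obtain ⟨hμ, hT⟩ := mem_sigma.1 hp
    have hT := (mem_filter.1 hT).2
    have hs := innerShape_extendFilling hlam hM hμ hT
    simp only at hs ⊢
    rw [hs, restrictFilling_extendFilling hT]
  · intro T hT
    have hT := (mem_filter.1 hT).2
    rw [← tableauWeight_extendFilling x hM (hT.innerShape_mem_interlacing hlam hM),
      extendFilling_restrictFilling hT]

lemma sum_tableauWeight_zero [NeZero K] {lam : Fin r → ℕ} (hM : ∀ i, lam i ≤ M) :
    ∑ T : Fin r → Fin M → Fin K with IsTableau 0 lam T, tableauWeight x lam T =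
      if lam = 0 then 1 else 0 := by
  split_ifs with h
  · subst h
    have : univ.filter (fun T : Fin r → Fin M → Fin K ↦ IsTableau 0 0 T) = {fun _ _ ↦ 0} := by
      ext T
      rw [mem_filter, mem_singleton]
      constructor
      · intro hT
        funext i c
        exact Fin.ext ((hT.2.zero i c (Nat.zero_le _)).trans (Fin.val_zero K).symm)
      · rintro rfl
        refine ⟨mem_univ _, ?_, ?_, ?_, ?_⟩ <;> simp
    rw [this, sum_singleton]
    simp [tableauWeight]
  · obtain ⟨i, hi⟩ := Function.ne_iff.1 h
    have hi : 0 < lam i := Nat.pos_of_ne_zero hi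
    refine sum_eq_zero fun T hT ↦ ?_
    exact absurd ((mem_filter.1 hT).2.lt i ⟨0, hi.trans_le (hM i)⟩ hi) (Nat.not_lt_zero _)

/-- The Jacobi–Trudi identity in the first `n` variables. -/
lemma sum_tableauWeight_eq_jacobiTrudiDet [NeZero K] {n : ℕ} (hn : n ≤ K) {lam : Fin r → ℕ}
    (hlam : Antitone lam) (hM : ∀ i, lam i ≤ M) :
    ∑ T : Fin r → Fin M → Fin K with IsTableau n lam T, tableauWeight x lam T =
      jacobiTrudiDet x {k : Fin K | (k : ℕ) < n} lam := by
  induction n generalizing lam with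
  | zero =>
    rw [sum_tableauWeight_zero x hM, ← jacobiTrudiDet_empty x hlam]
    simp
  | succ n ih =>
    have hins : (univ.filter fun k : Fin K ↦ (k : ℕ) < n + 1) =
        insert ⟨n, hn⟩ (univ.filter fun k : Fin K ↦ (k : ℕ) < n) := by
      ext k
      simp only [mem_filter, mem_univ, true_and, mem_insert, Fin.ext_iff]
      omega
    rw [hins, jacobiTrudiDet_insert x (by simp) hlam, sum_tableauWeight_succ x ⟨n, hn⟩ hlam hM]
    refine sum_congr rfl fun μ hμ ↦ ?_
    rw [← ih (by omega) (antitone_of_mem_interlacing hlam hμ)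
      fun i ↦ (mem_interlacing.1 hμ i).2.trans (hM i)]

lemma tableauWeight_eq_prod_pow (lam : Fin r → ℕ) (T : Fin r → Fin M → Fin K) :
    tableauWeight x lam T =
      ∏ k, x k ^ #{q : Fin r × Fin M | (q.2 : ℕ) < lam q.1 ∧ T q.1 q.2 = k} := by
  unfold tableauWeight
  rw [← Fintype.prod_prod_type' fun i (c : Fin M) ↦ if (c : ℕ) < lam i then x (T i c) else 1,
    ← prod_filter, ← prod_fiberwise _ fun q : Fin r × Fin M ↦ T q.1 q.2]
  refine prod_congr rfl fun k _ ↦ ?_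
  rw [← filter_filter]
  exact prod_eq_pow_card fun q hq ↦ by rw [(mem_filter.1 hq).2]

end Tableaux

lemma hciz_eq_completeHom (N : ℕ) (m : ℤ) :
    hciz N m = completeHom (MvPolynomial.X : Fin N → MvPolynomial (Fin N) ℤ) univ m := by
  unfold hciz completeHom
  split_ifs
  · rw [sym_univ, MvPolynomial.hsymm]
    rfl
  · rfl

/-- **The Jacobi–Trudi identity.**  Let `λ = (λ_1 ≥ … ≥ λ_r ≥ 0)` be a partition
of length `r` and `N ≥ 1`.  An `N`-semistandard Young tableau of shape `λ` is a
filling of the Ferrers board of `λ` (cells `(i, c)` with `c < λ i`, the column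
index `c` running over `Fin M` with `M` the largest part) with entries in `Fin N`
(the `N` values, `0`-indexed) that weakly increases along rows and strictly
increases down columns; fillings are normalised by the value `0` outside the
board.  Then the generating polynomial `Σ_T Π_k x_k^{m(T,k)}` of all such
tableaux, `m(T,k)` being the number of entries of `T` equal to `k`, equals
`det (h_{λ_i − i + j})_{i,j=1}^r`. -/
theorem jacobi_trudi (N : ℕ) (hN : 1 ≤ N) (r : ℕ) (lam : Fin r → ℕ)
    (hlam : Antitone lam) :
    (∑ T ∈ Finset.univ.filter
        (fun T : Fin r → Fin (Finset.univ.sup lam) → Fin N =>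
          -- rows weakly increase
          (∀ (i : Fin r) (c c' : Fin (Finset.univ.sup lam)),
            c ≤ c' → (c' : ℕ) < lam i → T i c ≤ T i c') ∧
          -- columns strictly increase
          (∀ (i i' : Fin r) (c : Fin (Finset.univ.sup lam)),
            i < i' → (c : ℕ) < lam i' → T i c < T i' c) ∧
          -- normalisation outside the Ferrers board
          (∀ (i : Fin r) (c : Fin (Finset.univ.sup lam)),
            lam i ≤ (c : ℕ) → (T i c : ℕ) = 0)),
      ∏ k : Fin N,
        (MvPolynomial.X k : MvPolynomial (Fin N) ℤ) ^
          ((Finset.univ.filter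
              (fun q : Fin r × Fin (Finset.univ.sup lam) =>
                (q.2 : ℕ) < lam q.1 ∧ T q.1 q.2 = k)).card))
    = (Matrix.of fun i j : Fin r =>
        hciz N ((lam i : ℤ) - (i : ℕ) + (j : ℕ))).det := by
  have : NeZero N := ⟨by omega⟩
  have key := sum_tableauWeight_eq_jacobiTrudiDet (M := univ.sup lam)
    (MvPolynomial.X : Fin N → MvPolynomial (Fin N) ℤ) le_rfl hlam fun i ↦ le_sup (mem_univ i)
  simp only [jacobiTrudiDet, Fin.is_lt, filter_true, ← hciz_eq_completeHom,
    tableauWeight_eq_prod_pow] at key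
  rw [← key]
  refine sum_congr (filter_congr fun T _ ↦ ?_) fun T _ ↦ ?_
  · exact ⟨fun h ↦ ⟨h.1, h.2.1, h.2.2, fun i c _ ↦ (T i c).2⟩,
      fun h ↦ ⟨h.row, h.col, h.zero⟩⟩
  · rfl
end

section
/- Let R be a nontrivial commutative ring and n ≥ 1. The complete homogeneous symmetric polynomials h_1, h_2, …, h_n in the n variables x_1,…,x_n, regarded as elements of the polynomial ring R[x_1,…,x_n], form an algebraically independent family over R. -/
open Finset

namespace PowerSeries

theorem one_sub_C_mul_X_mul_mk_pow {A : Type*} [CommRing A] (a : A) :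
    (1 - C a * X) * mk (fun k => a ^ k) = 1 := by
  ext k
  cases k with
  | zero => simp [sub_mul, mul_assoc]
  | succ k => simp [sub_mul, mul_assoc, coeff_succ_X_mul, pow_succ', coeff_one]

end PowerSeries

namespace MvPolynomial

variable (σ R : Type*) [Fintype σ] [CommRing R]

theorem prod_one_sub_C_X_mul_X :
    ∏ i : σ, (1 - PowerSeries.C (X i : MvPolynomial σ R) * PowerSeries.X) =
      PowerSeries.mk fun k => (-1) ^ k * esymm σ R k := by
  classical
  ext1 k
  simp_rw [sub_eq_add_neg, Finset.prod_one_add, map_sum, PowerSeries.coeff_mk, esymm,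
    ← neg_mul, prod_mul_distrib, prod_const, ← map_neg, ← map_prod, PowerSeries.coeff_C_mul,
    PowerSeries.coeff_X_pow, prod_neg, mul_ite, mul_one, mul_zero, ← sum_filter, mul_sum]
  refine sum_congr ?_ ?_
  · ext t; simp [mem_powersetCard, eq_comm]
  · intro t ht
    rw [(mem_powersetCard.mp ht).2]

variable [DecidableEq σ]

theorem hsymm_eq_sum_finsuppAntidiag (k : ℕ) :
    hsymm σ R k = ∑ d ∈ finsuppAntidiag univ k, ∏ i, (X i : MvPolynomial σ R) ^ d i := by
  rw [hsymm]
  refine sum_bij (fun s _ => Multiset.toFinsupp (s : Multiset σ)) ?_ ?_ ?_ ?_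
  · intro s _
    refine mem_finsuppAntidiag.mpr ⟨?_, subset_univ _⟩
    have h := Multiset.toFinsupp_sum_eq (s : Multiset σ)
    rw [Finsupp.sum_fintype _ _ (by simp)] at h
    exact h.trans s.2
  · intro s _ t _ h
    exact Sym.coe_injective (Multiset.toFinsupp.injective h)
  · intro d hd
    refine ⟨⟨Finsupp.toMultiset d, ?_⟩, mem_univ _, Finsupp.toMultiset_toFinsupp d⟩
    rw [Finsupp.card_toMultiset, Finsupp.sum_fintype _ _ (by simp)]
    exact (mem_finsuppAntidiag.mp hd).1
  · intro s _
    simp_rw [Multiset.toFinsupp_apply]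
    rw [prod_multiset_map_count]
    refine prod_subset (subset_univ _) fun i _ hi => ?_
    rw [Multiset.count_eq_zero_of_notMem (by simpa using hi), pow_zero]

theorem prod_mk_X_pow :
    ∏ i : σ, PowerSeries.mk (fun k => (X i : MvPolynomial σ R) ^ k) =
      PowerSeries.mk (hsymm σ R) := by
  ext1 k
  simp_rw [PowerSeries.coeff_prod, PowerSeries.coeff_mk, hsymm_eq_sum_finsuppAntidiag]

theorem sum_antidiagonal_neg_one_pow_mul_esymm_mul_hsymm {k : ℕ} (hk : k ≠ 0) :
    ∑ p ∈ antidiagonal k, (-1) ^ p.1 * esymm σ R p.1 * hsymm σ R p.2 = 0 := by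
  have h : (PowerSeries.mk fun k => (-1) ^ k * esymm σ R k) * PowerSeries.mk (hsymm σ R) = 1 := by
    rw [← prod_one_sub_C_X_mul_X, ← prod_mk_X_pow, ← prod_mul_distrib]
    exact prod_eq_one fun i _ => PowerSeries.one_sub_C_mul_X_mul_mk_pow _
  simpa [PowerSeries.coeff_mul, PowerSeries.coeff_one, hk] using congrArg (PowerSeries.coeff k) h

end MvPolynomial

open MvPolynomial

theorem sum_antidiagonal_neg_one_pow_mul_mul_swap {A : Type*} [CommRing A] {f g : ℕ → A} {k : ℕ}
    (h : ∑ p ∈ antidiagonal k, (-1) ^ p.1 * f p.1 * g p.2 = 0) :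
    ∑ p ∈ antidiagonal k, (-1) ^ p.1 * g p.1 * f p.2 = 0 := by
  rw [← Finset.Nat.sum_antidiagonal_swap]
  calc _ = (-1) ^ k * ∑ p ∈ antidiagonal k, (-1) ^ p.1 * f p.1 * g p.2 := by
        rw [mul_sum]
        refine sum_congr rfl fun p hp => ?_
        rw [← mem_antidiagonal.mp hp, pow_add]
        have : ((-1 : A) ^ p.1) * (-1) ^ p.1 = 1 := by rw [← mul_pow]; simp
        simp only [Prod.fst_swap, Prod.snd_swap]
        linear_combination (-(-1) ^ p.2 * f p.1 * g p.2) * this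
    _ = 0 := by rw [h, mul_zero]

theorem eq_sum_of_sum_antidiagonal_eq_zero {A : Type*} [CommRing A] {f g : ℕ → A}
    (hf : f 0 = 1) {k : ℕ}
    (h : ∑ p ∈ antidiagonal (k + 1), (-1) ^ p.1 * f p.1 * g p.2 = 0) :
    g (k + 1) = ∑ i : Fin (k + 1), (-1) ^ (i : ℕ) * f (i + 1) * g (k - i) := by
  rw [Nat.sum_antidiagonal_succ, Nat.sum_antidiagonal_eq_sum_range_succ_mk, hf] at h
  rw [Fin.sum_univ_eq_sum_range (fun i => (-1) ^ i * f (i + 1) * g (k - i))]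
  simp only [pow_succ, mul_neg, neg_mul, sum_neg_distrib, mul_one, pow_zero, one_mul] at h
  exact eq_of_sub_eq_zero (by rw [sub_eq_add_neg]; exact h)

/-- The coefficients of the power series inverse to `1 + ∑ i, (-1) ^ (i + 1) * x i * T ^ (i + 1)`. -/
def dualCoeff {A : Type*} [CommRing A] (x : ℕ → A) : ℕ → A
  | 0 => 1
  | k + 1 => ∑ i : Fin (k + 1), (-1) ^ (i : ℕ) * x i * dualCoeff x (k - i)

theorem map_dualCoeff {A B : Type*} [CommRing A] [CommRing B] (φ : B →+* A) {f g : ℕ → A}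
    (hf : f 0 = 1) (hg : g 0 = 1)
    (h : ∀ k ≠ 0, ∑ p ∈ antidiagonal k, (-1) ^ p.1 * f p.1 * g p.2 = 0)
    {n : ℕ} {x : ℕ → B} (hx : ∀ i < n, φ (x i) = f (i + 1)) {k : ℕ} (hk : k ≤ n) :
    φ (dualCoeff x k) = g k := by
  induction k using Nat.strong_induction_on with
  | _ k ih =>
    cases k with
    | zero => simp [dualCoeff, hg]
    | succ k =>
      rw [dualCoeff, eq_sum_of_sum_antidiagonal_eq_zero hf (h _ k.succ_ne_zero), map_sum]
      refine sum_congr rfl fun i _ => ?_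
      simp [ih (k - i) (by omega) (by omega), hx i (by omega)]

theorem AlgebraicIndependent.of_sum_antidiagonal_eq_zero {R A : Type*} [CommRing R] [CommRing A]
    [Algebra R A] {f g : ℕ → A} (hf : f 0 = 1) (hg : g 0 = 1)
    (h : ∀ k ≠ 0, ∑ p ∈ antidiagonal k, (-1) ^ p.1 * f p.1 * g p.2 = 0) {n : ℕ}
    (hind : AlgebraicIndependent R fun i : Fin n => f (i + 1)) :
    AlgebraicIndependent R fun i : Fin n => g (i + 1) := by
  let x (i : ℕ) : MvPolynomial (Fin n) R := if hi : i < n then X ⟨i, hi⟩ else 0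
  let ω : MvPolynomial (Fin n) R →ₐ[R] MvPolynomial (Fin n) R :=
    aeval fun i => dualCoeff x (i + 1)
  have key {u v : ℕ → A} (hu : u 0 = 1) (hv : v 0 = 1)
      (huv : ∀ k ≠ 0, ∑ p ∈ antidiagonal k, (-1) ^ p.1 * u p.1 * v p.2 = 0) :
      (aeval fun i : Fin n => u (i + 1)).comp ω = aeval (R := R) fun i : Fin n => v (i + 1) := by
    ext i
    have hx : ∀ j < n, (aeval (R := R) fun i : Fin n => u (i + 1)) (x j) = u (j + 1) :=
      fun j hj => by simp [x, hj]
    simpa [ω] using map_dualCoeff (aeval (R := R) fun i : Fin n => u (i + 1)).toRingHom hu hv huv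
      hx (Nat.succ_le_of_lt i.2)
  have hfg := key hf hg h
  have hgf := key hg hf fun k hk => sum_antidiagonal_neg_one_pow_mul_mul_swap (h k hk)
  have hω : Function.Injective ω := by
    refine Function.Injective.of_comp (f := aeval fun i : Fin n => g (i + 1)) ?_
    rw [← AlgHom.coe_comp, hgf]
    exact hind
  rw [AlgebraicIndependent, ← hfg, AlgHom.coe_comp]
  exact Function.Injective.comp hind hω

theorem MvPolynomial.algebraicIndependent_esymm (σ R : Type*) [Fintype σ] [CommRing R] {n : ℕ}
    (hn : n ≤ Fintype.card σ) :
    AlgebraicIndependent R fun i : Fin n => esymm σ R (i + 1) := by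
  intro p q hpq
  refine esymmAlgHom_injective (R := R) hn (Subtype.ext ?_)
  simpa only [esymmAlgHom_apply] using hpq

theorem MvPolynomial.algebraicIndependent_hsymm (σ R : Type*) [Fintype σ] [DecidableEq σ]
    [CommRing R] {n : ℕ} (hn : n ≤ Fintype.card σ) :
    AlgebraicIndependent R fun i : Fin n => hsymm σ R (i + 1) :=
  .of_sum_antidiagonal_eq_zero (esymm_zero σ R) (hsymm_zero σ R)
    (fun _ => sum_antidiagonal_neg_one_pow_mul_esymm_mul_hsymm σ R)
    (algebraicIndependent_esymm σ R hn)

/-- **Algebraic independence of the complete homogeneous symmetric polynomials.**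
For a nontrivial commutative ring `R` and `n ≥ 1`, the complete homogeneous
symmetric polynomials `h_1, h_2, …, h_n` in the `n` variables `x_1, …, x_n`
(here `MvPolynomial.hsymm (Fin n) R m` is the sum of all monomials of total
degree `m`), regarded as elements of `R[x_1,…,x_n]`, form an algebraically
independent family over `R`. -/
theorem hsymm_algebraicIndependent (R : Type*) [CommRing R] [Nontrivial R]
    (n : ℕ) (hn : 1 ≤ n) :
    AlgebraicIndependent R
      (fun i : Fin n => MvPolynomial.hsymm (Fin n) R ((i : ℕ) + 1)) :=
  MvPolynomial.algebraicIndependent_hsymm (Fin n) R (Fintype.card_fin n).ge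
end
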